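/- Fix k ≥ 2 and let p be a real polynomial of degree ℓ that is non-negative and non-decreasing on [0,∞). Let σ_1,…,σ_k be independent uniform on S_n, η uniform on A_n, and π uniform on S_n. Then (i) there is a constant C > 0 with | E[p(C(w_c(σ_1,…,σ_k)))] − E[p(C(η))] | ≤ C (log n)^ℓ / n^{k−1} for even k (and ≤ C (log n)^ℓ / n^{k−2} for odd k) for all n ≥ 2, and (ii) E[p(C(σ_1⋯σ_k))] = E[p(C(π))] and E[p(C(σ_1⁻¹⋯σ_k⁻¹))] = E[p(C(π))] exactly. -/

import Mathlib

/-- Number of cycles of a permutation of `Fin n`, counting fixed points as 1-cycles. -/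
def numCycles {n : ℕ} (π : Equiv.Perm (Fin n)) : ℕ :=
  Multiset.card π.cycleType + (Finset.univ.filter fun i => π i = i).card

/-- `w_c(σ_1, …, σ_k) = σ_1 ⋯ σ_k · σ_1⁻¹ ⋯ σ_k⁻¹`. -/
def wc {n k : ℕ} (v : Fin k → Equiv.Perm (Fin n)) : Equiv.Perm (Fin n) :=
  (List.ofFn v).prod * (List.ofFn fun i => (v i)⁻¹).prod

set_option linter.unusedSectionVars false

namespace MVC
open Representation

section gen
variable {G V : Type} [Group G] [Fintype G] [AddCommGroup V] [Module ℂ V] [FiniteDimensional ℂ V]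
variable (ρ : Representation ℂ G V)

lemma rho_mul_inv (g : G) : ρ g * ρ g⁻¹ = 1 := by rw [← map_mul]; simp
lemma rho_inv_mul (g : G) : ρ g⁻¹ * ρ g = 1 := by rw [← map_mul]; simp

lemma exists_ne_zero_of_irr [ρ.IsIrreducible] : ∃ v : V, v ≠ 0 := by
  by_contra h
  push Not at h
  have : (⊥ : Subrepresentation ρ) = ⊤ := by
    apply Subrepresentation.toSubmodule_injective
    ext x
    have := h x
    subst this
    simp
  exact bot_ne_top this

lemma finrank_pos_of_irr [ρ.IsIrreducible] : 0 < Module.finrank ℂ V := by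
  obtain ⟨v, hv⟩ := exists_ne_zero_of_irr ρ
  exact Module.finrank_pos_iff_exists_ne_zero.2 ⟨v, hv⟩

lemma d_ne_zero [ρ.IsIrreducible] : (Module.finrank ℂ V : ℂ) ≠ 0 := by
  exact_mod_cast (finrank_pos_of_irr ρ).ne'

lemma scalar_of_commute [ρ.IsIrreducible] (M : Module.End ℂ V)
    (h : ∀ g, M * ρ g = ρ g * M) : ∃ c : ℂ, M = c • 1 := by
  let f : IntertwiningMap ρ ρ := ⟨M, fun g => h g⟩
  obtain ⟨c, hc⟩ := (IsIrreducible.algebraMap_intertwiningMap_bijective_of_isAlgClosed (ρ := ρ)).2 f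
  refine ⟨c, ?_⟩
  have := congrArg IntertwiningMap.toLinearMap hc
  exact this.symm

lemma scalar_of_commute' [ρ.IsIrreducible] (M : Module.End ℂ V)
    (h : ∀ g, M * ρ g = ρ g * M) :
    M = (LinearMap.trace ℂ V M / Module.finrank ℂ V) • 1 := by
  obtain ⟨c, rfl⟩ := scalar_of_commute ρ M h
  have := d_ne_zero ρ
  simp only [map_smul, LinearMap.trace_one, smul_eq_mul]
  field_simp

lemma avg_commute (A : Module.End ℂ V) (g : G) :
    (∑ y, ρ y * A * ρ y⁻¹) * ρ g = ρ g * ∑ y, ρ y * A * ρ y⁻¹ := by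
  rw [Finset.sum_mul, Finset.mul_sum]
  apply Fintype.sum_equiv (Equiv.mulLeft g⁻¹)
  intro x
  simp only [Equiv.coe_mulLeft, mul_inv_rev, inv_inv, map_mul]
  simp only [← mul_assoc, rho_mul_inv, one_mul]

lemma sum_conj_eq [ρ.IsIrreducible] (A : Module.End ℂ V) :
    ∑ y, ρ y * A * ρ y⁻¹ =
      (Nat.card G * LinearMap.trace ℂ V A / Module.finrank ℂ V : ℂ) • 1 := by
  have := scalar_of_commute' ρ _ (avg_commute ρ A)
  rw [this]
  congr 2
  rw [map_sum]
  have : ∀ y : G, LinearMap.trace ℂ V (ρ y * A * ρ y⁻¹) = LinearMap.trace ℂ V A := by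
    intro y
    rw [LinearMap.trace_mul_comm, ← mul_assoc, rho_inv_mul, one_mul]
  simp [this]

lemma sum_char_conj [ρ.IsIrreducible] (a b : G) :
    (∑ y, ρ.character (a * (y * b * y⁻¹))) =
      Nat.card G * ρ.character a * ρ.character b / Module.finrank ℂ V := by
  have h := sum_conj_eq ρ (ρ b)
  have h2 := congrArg (fun M => LinearMap.trace ℂ V (ρ a * M)) h
  simp only [Finset.mul_sum, map_sum] at h2
  simp only [Representation.character, map_mul]
  rw [h2]
  simp
  ring

lemma eq_zero_of_trace [ρ.IsIrreducible] (M : Module.End ℂ V)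
    (h : ∀ g, LinearMap.trace ℂ V (M * ρ g) = 0) : M = 0 := by
  ext w
  by_contra hw
  obtain ⟨l, hl⟩ : ∃ l : Module.Dual ℂ V, l (M w) ≠ 0 := by
    by_contra hcon
    push Not at hcon
    exact hw ((Module.forall_dual_apply_eq_zero_iff ℂ _).1 hcon)
  have key : ∑ y, l (ρ y⁻¹ w) • ρ y = (Nat.card G / Module.finrank ℂ V : ℂ) • l.smulRight w := by
    ext v
    have := LinearMap.congr_fun (sum_conj_eq ρ (l.smulRight v)) w
    simp only [LinearMap.sum_apply, Module.End.mul_apply, LinearMap.smulRight_apply, map_smul,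
      LinearMap.trace_smulRight] at this
    simp only [LinearMap.sum_apply, LinearMap.smul_apply, LinearMap.smulRight_apply]
    rw [this]
    simp [smul_smul]
    ring_nf
  have h2 := congrArg (fun A => LinearMap.trace ℂ V (M * A)) key
  simp only [Finset.mul_sum, map_sum, mul_smul_comm, map_smul, h] at h2
  have h3 : M * l.smulRight w = l.smulRight (M w) := by ext; simp
  rw [h3, LinearMap.trace_smulRight] at h2
  have := d_ne_zero ρ
  have : (Nat.card G : ℂ) ≠ 0 := by simp
  simp_all

/-- subrepresentation -/
def sub (W : Submodule ℂ V) (hW : ∀ g, ∀ w ∈ W, ρ g w ∈ W) : Representation ℂ G W :=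
  Subrepresentation.toRepresentation (ρ := ρ) ⟨W, fun g _ hw => hW g _ hw⟩

@[simp] lemma sub_apply (W : Submodule ℂ V) (hW : ∀ g, ∀ w ∈ W, ρ g w ∈ W) (g : G) (w : W) :
    ((sub ρ W hW g w : W) : V) = ρ g w := rfl

lemma exists_irr_sub (W : Submodule ℂ V) (hW : ∀ g, ∀ w ∈ W, ρ g w ∈ W) (hne : W ≠ ⊥) :
    ∃ U ≤ W, ∃ hU : ∀ g, ∀ w ∈ U, ρ g w ∈ U, (sub ρ U hU).IsIrreducible := by
  let S : Set (Submodule ℂ V) := {U | U ≤ W ∧ U ≠ ⊥ ∧ ∀ g, ∀ w ∈ U, ρ g w ∈ U}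
  obtain ⟨U, ⟨hUW, hU0, hU⟩, hmin⟩ := WellFounded.has_min
    (wellFounded_lt (α := Submodule ℂ V)) S ⟨W, le_rfl, hne, hW⟩
  refine ⟨U, hUW, hU, ?_⟩
  have hnt : Nontrivial (Subrepresentation (sub ρ U hU)) := by
    refine ⟨⊥, ⊤, fun h => hU0 ?_⟩
    rw [eq_bot_iff]
    intro x hx
    have : (⟨x, hx⟩ : U) ∈ (⊥ : Subrepresentation (sub ρ U hU)) := by
      rw [h]; exact Submodule.mem_top (R := ℂ)
    have h3 : (⟨x, hx⟩ : U) ∈ (⊥ : Submodule ℂ U) := this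
    simpa using h3
  refine { toNontrivial := hnt, eq_bot_or_eq_top := fun T => ?_ }
  have hinv : ∀ g, ∀ w ∈ T.toSubmodule.map U.subtype, ρ g w ∈ T.toSubmodule.map U.subtype := by
    rintro g _ ⟨w, hw, rfl⟩
    exact ⟨sub ρ U hU g w, T.apply_mem_toSubmodule g hw, rfl⟩
  by_cases h0 : T.toSubmodule = ⊥
  · left
    exact Subrepresentation.toSubmodule_injective h0
  · right
    apply Subrepresentation.toSubmodule_injective
    have hle : T.toSubmodule.map U.subtype ≤ U := Submodule.map_subtype_le _ _
    have hnlt := hmin (T.toSubmodule.map U.subtype) ⟨hle.trans hUW, by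
      intro hb
      apply h0
      rw [eq_bot_iff]
      intro x hx
      have hx2 : U.subtype x ∈ T.toSubmodule.map U.subtype := ⟨x, hx, rfl⟩
      rw [hb] at hx2
      simpa using hx2, hinv⟩
    have heq : T.toSubmodule.map U.subtype = U := by
      by_contra hne
      exact hnlt (lt_of_le_of_ne hle hne)
    refine (eq_top_iff (a := T.toSubmodule)).2 ?_
    rintro ⟨x, hx⟩ -
    have hx' := hx
    rw [← heq] at hx'
    obtain ⟨y, hy, hyx⟩ := hx'
    have : (⟨x, hx⟩ : U) = y := Subtype.ext hyx.symm
    rw [this]; exact hy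

lemma exists_proj (W : Submodule ℂ V) (hW : ∀ g, ∀ w ∈ W, ρ g w ∈ W) :
    ∃ P : Module.End ℂ V, (∀ g, P * ρ g = ρ g * P) ∧ (∀ v, P v ∈ W) ∧ ∀ w ∈ W, P w = w := by
  obtain ⟨π, hπ⟩ := W.subtype.exists_leftInverse_of_injective W.ker_subtype
  have hcard : (Nat.card G : ℂ) ≠ 0 := by simp
  let A : Module.End ℂ V := W.subtype ∘ₗ π
  have hA : ∀ w ∈ W, A w = w := by
    intro w hw
    have := LinearMap.congr_fun hπ ⟨w, hw⟩
    simp only [A, LinearMap.comp_apply, LinearMap.id_apply, Submodule.subtype_apply] at this ⊢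
    rw [this]
  refine ⟨(Nat.card G : ℂ)⁻¹ • ∑ y, ρ y * A * ρ y⁻¹, fun g => ?_, fun v => ?_, fun w hw => ?_⟩
  · rw [smul_mul_assoc, avg_commute, mul_smul_comm]
  · simp only [LinearMap.smul_apply, LinearMap.sum_apply]
    apply W.smul_mem
    apply W.sum_mem
    intro y _
    exact hW _ _ (Submodule.coe_mem _)
  · simp only [LinearMap.smul_apply, LinearMap.sum_apply, Module.End.mul_apply]
    have : ∀ y, ρ y (A (ρ y⁻¹ w)) = w := by
      intro y
      rw [hA _ (hW _ _ hw), ← Module.End.mul_apply, rho_mul_inv]; rfl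
    simp only [this]
    simp [← Nat.cast_smul_eq_nsmul ℂ]

end gen

section chars
variable {G : Type} [Group G] [Fintype G]

/-- bilinear inner product -/
noncomputable def inn (f h : G → ℂ) : ℂ := (Nat.card G : ℂ)⁻¹ * ∑ g, f g * h g⁻¹

/-- irreducible characters -/
def IsIrr (χ : G → ℂ) : Prop :=
  ∃ (V : Type) (_ : AddCommGroup V) (_ : Module ℂ V) (_ : FiniteDimensional ℂ V)
    (ρ : Representation ℂ G V), ρ.IsIrreducible ∧ χ = ρ.character

/-- class functions -/
def IsClass (f : G → ℂ) : Prop := ∀ g h, f (h * g * h⁻¹) = f g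

lemma IsClass.comm {f : G → ℂ} (hf : IsClass f) (g h : G) : f (g * h) = f (h * g) := by
  have := hf (g * h) h
  rw [← this]; congr 1; group

lemma IsIrr.isClass {χ : G → ℂ} (h : IsIrr χ) : IsClass χ := by
  obtain ⟨V, _, _, _, ρ, hρ, rfl⟩ := h
  intro a b
  exact ρ.char_conj a b

lemma inn_comm (f h : G → ℂ) : inn f h = inn h f := by
  unfold inn
  congr 1
  apply Fintype.sum_equiv (Equiv.inv G)
  intro x
  simp [mul_comm]

lemma inn_sum_left {ι : Type*} (s : Finset ι) (f : ι → G → ℂ) (h : G → ℂ) :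
    inn (fun g => ∑ i ∈ s, f i g) h = ∑ i ∈ s, inn (f i) h := by
  unfold inn
  rw [← Finset.mul_sum, Finset.sum_comm]
  simp [Finset.sum_mul]

lemma inn_smul_left (c : ℂ) (f h : G → ℂ) : inn (fun g => c * f g) h = c * inn f h := by
  unfold inn
  simp only [Finset.mul_sum]
  refine Finset.sum_congr rfl fun _ _ => by ring

lemma inn_sub_left (f f' h : G → ℂ) : inn (fun g => f g - f' g) h = inn f h - inn f' h := by
  unfold inn
  simp only [sub_mul, Finset.sum_sub_distrib, mul_sub]

lemma IsIrr.inn_self {χ : G → ℂ} (h : IsIrr χ) : inn χ χ = 1 := by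
  obtain ⟨V, _, _, _, ρ, hρ, rfl⟩ := h
  have : Invertible (Nat.card G : ℂ) := invertibleOfNonzero (by simp)
  have := Representation.char_orthonormal ρ ρ
  unfold inn
  rw [this, if_pos ⟨Representation.Equiv.refl ρ⟩]

lemma IsIrr.inn_ne {χ ψ : G → ℂ} (h : IsIrr χ) (h' : IsIrr ψ) (hne : χ ≠ ψ) : inn χ ψ = 0 := by
  obtain ⟨V, _, _, _, ρ, hρ, rfl⟩ := h
  obtain ⟨V', _, _, _, ρ', hρ', rfl⟩ := h'
  have : Invertible (Nat.card G : ℂ) := invertibleOfNonzero (by simp)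
  have := Representation.char_orthonormal ρ ρ'
  unfold inn
  rw [this, if_neg]
  rintro ⟨e⟩
  exact hne (Representation.char_iso e).symm

/-- dimension -/
lemma IsIrr.deg {χ : G → ℂ} (h : IsIrr χ) : ∃ d : ℕ, 0 < d ∧ χ 1 = d := by
  obtain ⟨V, _, _, _, ρ, hρ, rfl⟩ := h
  exact ⟨_, finrank_pos_of_irr ρ, ρ.char_one⟩

/-- degree of a character -/
noncomputable def dg (χ : G → ℂ) : ℝ := (χ 1).re

lemma IsIrr.deg_eq {χ : G → ℂ} (h : IsIrr χ) : χ 1 = (dg χ : ℂ) := by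
  obtain ⟨d, _, hd⟩ := h.deg
  simp [dg, hd]

lemma IsIrr.one_le_deg {χ : G → ℂ} (h : IsIrr χ) : 1 ≤ dg χ := by
  obtain ⟨d, h0, hd⟩ := h.deg
  simp only [dg, hd, Complex.natCast_re]
  exact_mod_cast h0

lemma IsIrr.ne_zero {χ : G → ℂ} (h : IsIrr χ) : χ 1 ≠ 0 := by
  obtain ⟨d, h0, hd⟩ := h.deg
  rw [hd]; exact_mod_cast h0.ne'

lemma IsIrr.sum_conj {χ : G → ℂ} (h : IsIrr χ) (a b : G) :
    ∑ y, χ (a * (y * b * y⁻¹)) = Nat.card G * χ a * χ b / χ 1 := by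
  obtain ⟨V, _, _, _, ρ, hρ, rfl⟩ := h
  rw [sum_char_conj, ρ.char_one]

lemma class_commute {V : Type} [AddCommGroup V] [Module ℂ V] (ρ : Representation ℂ G V)
    {f : G → ℂ} (hf : IsClass f) (g : G) :
    (∑ y, f y • ρ y⁻¹) * ρ g = ρ g * ∑ y, f y • ρ y⁻¹ := by
  rw [Finset.sum_mul, Finset.mul_sum]
  apply Fintype.sum_equiv (MulAut.conj g⁻¹).toEquiv
  intro x
  have : f (g⁻¹ * x * g) = f x := by simpa using hf x g⁻¹
  simp only [MulEquiv.toEquiv_eq_coe, EquivLike.coe_coe, MulAut.conj_apply, inv_inv, this,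
    smul_mul_assoc, mul_smul_comm]
  rw [← map_mul, ← map_mul]
  congr 2
  group

lemma IsIrr.conv {χ : G → ℂ} (h : IsIrr χ) (g : G) :
    ∑ y, χ y * χ (y⁻¹ * g) = Nat.card G * χ g / χ 1 := by
  have h1 := h.inn_self
  have hcl := h.isClass
  obtain ⟨V, _, _, _, ρ, hρ, rfl⟩ := h
  have h2 := scalar_of_commute' ρ _ (class_commute ρ hcl)
  have h3 := congrArg (fun M => LinearMap.trace ℂ V (M * ρ g)) h2
  have hcard : (Nat.card G : ℂ) ≠ 0 := by simp
  simp only [Finset.sum_mul, map_sum, smul_mul_assoc, map_smul, one_mul, ← map_mul] at h3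
  unfold inn at h1
  rw [inv_mul_eq_one₀ hcard] at h1
  simp only [Representation.character, smul_eq_mul] at h1 h3 ⊢
  rw [h3, ← h1]
  simp
  ring

lemma class_zero_of_inn {f : G → ℂ} (hf : IsClass f) (h : ∀ χ, IsIrr χ → inn f χ = 0) :
    f = 0 := by
  classical
  have hcard : (Nat.card G : ℂ) ≠ 0 := by simp
  let ρ : Representation ℂ G (G → ℂ) :=
    { toFun := fun g => LinearMap.funLeft ℂ ℂ (fun x => x * g)
      map_one' := by ext; simp [LinearMap.funLeft_apply]
      map_mul' := by intro a b; ext; simp [LinearMap.funLeft_apply, mul_assoc] }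
  set z : Module.End ℂ (G → ℂ) := ∑ y, f y • ρ y⁻¹ with hz
  have hcomm := class_commute ρ hf
  rw [← hz] at hcomm
  have hcomm' : ∀ g v, z (ρ g v) = ρ g (z v) := fun g v => LinearMap.congr_fun (hcomm g) v
  have hker : ∀ g, ∀ w ∈ LinearMap.ker z, ρ g w ∈ LinearMap.ker z := by
    intro g w hw
    rw [LinearMap.mem_ker] at *
    rw [hcomm', hw, map_zero]
  obtain ⟨P, hP1, hP2, hP3⟩ := exists_proj ρ _ hker
  have hP1' : ∀ g v, P (ρ g v) = ρ g (P v) := fun g v => LinearMap.congr_fun (hP1 g) v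
  have hbot : LinearMap.ker P = ⊥ := by
    by_contra hne
    obtain ⟨U, hUle, hU, hirr⟩ := exists_irr_sub ρ (LinearMap.ker P) (by
      intro g w hw
      rw [LinearMap.mem_ker] at *
      rw [hP1', hw, map_zero]) hne
    have h1 := h _ ⟨U, _, _, inferInstance, sub ρ U hU, hirr, rfl⟩
    have h2 := scalar_of_commute' (sub ρ U hU) _ (class_commute (sub ρ U hU) hf)
    have h3 : ∑ y, f y • sub ρ U hU y⁻¹ = 0 := by
      rw [h2]
      have : LinearMap.trace ℂ U (∑ y, f y • sub ρ U hU y⁻¹) = 0 := by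
        unfold inn at h1
        simpa [Representation.character] using h1
      rw [this]; simp
    obtain ⟨⟨u, hu⟩, hu0⟩ := exists_ne_zero_of_irr (sub ρ U hU)
    have h4 : z u = 0 := by
      have := congrArg Subtype.val (LinearMap.congr_fun h3 ⟨u, hu⟩)
      simpa [hz, LinearMap.sum_apply] using this
    have h5 : P u = u := hP3 u h4
    have h6 : P u = 0 := hUle hu
    apply hu0
    apply Subtype.ext
    exact h5.symm.trans h6
  have hz0 : ∀ v, z v = 0 := by
    intro v
    have : P (v - P v) = 0 := by
      rw [map_sub, hP3 _ (hP2 v), sub_self]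
    have h2 : v - P v ∈ LinearMap.ker P := this
    rw [hbot, Submodule.mem_bot, sub_eq_zero] at h2
    rw [h2]
    exact hP2 v
  ext x
  have := congrFun (hz0 (Pi.single 1 1)) x
  simp only [hz, LinearMap.sum_apply, LinearMap.smul_apply, Finset.sum_apply, Pi.smul_apply,
    smul_eq_mul, Pi.zero_apply] at this
  rw [Finset.sum_eq_single x] at this
  · simpa [ρ, LinearMap.funLeft_apply] using this
  · intro b _ hb
    have : x * b⁻¹ ≠ 1 := by
      rw [Ne, mul_inv_eq_one]; exact fun h => hb h.symm
    simp [ρ, LinearMap.funLeft_apply, this]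
  · simp

variable (G) in
lemma irr_finite : {χ : G → ℂ | IsIrr χ}.Finite := by
  classical
  have : LinearIndependent ℂ (fun χ : {χ : G → ℂ | IsIrr χ} => (χ : G → ℂ)) := by
    rw [linearIndependent_iff']
    intro s c hc i hi
    have h1 : inn (fun g => ∑ j ∈ s, c j * (j : G → ℂ) g) i = 0 := by
      have : (fun g => ∑ j ∈ s, c j * (j : G → ℂ) g) = 0 := by
        rw [← hc]; ext g; simp
      rw [this]; simp [inn]
    rw [inn_sum_left, Finset.sum_eq_single i] at h1
    · rwa [inn_smul_left, i.2.inn_self, mul_one] at h1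
    · intro b _ hb
      rw [inn_smul_left, b.2.inn_ne i.2 (fun h => hb (Subtype.ext h)), mul_zero]
    · exact fun h => absurd hi h
  exact this.setFinite

variable (G) in
/-- finset of irreducible characters -/
noncomputable def irr : Finset (G → ℂ) := (irr_finite G).toFinset

lemma mem_irr {χ : G → ℂ} : χ ∈ irr G ↔ IsIrr χ := by simp [irr]

lemma expand {f : G → ℂ} (hf : IsClass f) (g : G) : f g = ∑ χ ∈ irr G, inn f χ * χ g := by
  classical
  have : (fun g => f g - ∑ χ ∈ irr G, inn f χ * χ g) = 0 := by
    apply class_zero_of_inn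
    · intro a b
      simp only [hf a b]
      congr 1
      refine Finset.sum_congr rfl fun χ hχ => ?_
      rw [(mem_irr.1 hχ).isClass]
    · intro ψ hψ
      rw [inn_sub_left, inn_sum_left, Finset.sum_eq_single ψ]
      · rw [inn_smul_left, hψ.inn_self, mul_one, sub_self]
      · intro b hb hne
        rw [inn_smul_left, (mem_irr.1 hb).inn_ne hψ hne, mul_zero]
      · exact fun h => absurd (mem_irr.2 hψ) h
  have := congrFun this g
  simpa [sub_eq_zero] using this

lemma inn_expand {f h : G → ℂ} (hf : IsClass f) :
    inn f h = ∑ χ ∈ irr G, inn f χ * inn χ h := by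
  have : f = fun g => ∑ χ ∈ irr G, inn f χ * χ g := funext (expand hf)
  conv_lhs => rw [this]
  rw [inn_sum_left]
  simp [inn_smul_left]

open ComplexOrder in
lemma char_inv_eq_conj {V : Type} [AddCommGroup V] [Module ℂ V] [FiniteDimensional ℂ V]
    (ρ : Representation ℂ G V) (g : G) : ρ.character g⁻¹ = star (ρ.character g) := by
  classical
  let b := Module.finBasis ℂ V
  let A : G → Matrix _ _ ℂ := fun g => LinearMap.toMatrix b b (ρ g)
  have hA : ∀ x y, A (x * y) = A x * A y := by
    intro x y
    simp only [A, map_mul]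
    exact LinearMap.toMatrix_mul b _ _
  have hA1 : A 1 = 1 := by simp only [A, map_one]; exact LinearMap.toMatrix_one b
  have htr : ∀ x, ρ.character x = (A x).trace := fun x =>
    LinearMap.trace_eq_matrix_trace ℂ b _
  let H := ∑ x, (A x).conjTranspose * A x
  have hH : H.PosDef := by
    apply Matrix.posDef_sum Finset.univ_nonempty
    intro x _
    apply Matrix.PosDef.conjTranspose_mul_self
    apply Matrix.mulVec_injective_of_isUnit
    rw [Matrix.isUnit_iff_isUnit_det]
    apply Matrix.isUnit_det_of_left_inverse (B := A x⁻¹)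
    rw [← hA]; simp [hA1]
  have hinv : (A g).conjTranspose * H * A g = H := by
    simp only [H, Finset.mul_sum, Finset.sum_mul]
    apply Fintype.sum_equiv (Equiv.mulRight g)
    intro x
    simp only [Equiv.coe_mulRight, hA, Matrix.conjTranspose_mul, mul_assoc]
  have hAi : A g * A g⁻¹ = 1 := by rw [← hA]; simp [hA1]
  have hdet : IsUnit H.det := (Matrix.isUnit_iff_isUnit_det _).1 hH.isUnit
  have h2 : (A g).conjTranspose * H = H * A g⁻¹ := by
    calc _ = (A g).conjTranspose * H * (A g * A g⁻¹) := by rw [hAi, mul_one]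
      _ = _ := by rw [← mul_assoc, hinv]
  have h3 : A g⁻¹ = H⁻¹ * ((A g).conjTranspose * H) := by
    rw [h2, ← mul_assoc, Matrix.nonsing_inv_mul _ hdet, one_mul]
  rw [htr, htr, h3, Matrix.trace_mul_comm, mul_assoc, Matrix.mul_nonsing_inv _ hdet, mul_one,
    Matrix.trace_conjTranspose]

end chars
end MVC
set_option linter.unusedSectionVars false
namespace MVC
open Representation Equiv

/-- symmetric group -/
abbrev S (n : ℕ) := Equiv.Perm (Fin n)

/-- embedding fixing zero -/
def io (n : ℕ) : S n →* S (n + 1) where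
  toFun e := Equiv.Perm.decomposeFin.symm (0, e)
  map_one' := by simp; rfl
  map_mul' a b := by
    ext i
    refine Fin.cases ?_ (fun j => ?_) i
    · simp
    · simp [Equiv.Perm.decomposeFin_symm_apply_succ]

@[simp] lemma io_zero {n : ℕ} (e : S n) : io n e 0 = 0 := by simp [io]
@[simp] lemma io_succ {n : ℕ} (e : S n) (i : Fin n) : io n e i.succ = (e i).succ := by simp [io]

lemma io_inj {n : ℕ} : Function.Injective (io n) := by
  intro a b h
  ext i
  have := congrArg (fun g => g i.succ) h
  simp only [io_succ, Fin.succ_inj] at this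
  rw [this]

lemma dec_eq {n : ℕ} (p : Fin (n + 1)) (e : S n) :
    Equiv.Perm.decomposeFin.symm (p, e) = swap 0 p * io n e := by
  ext i
  refine Fin.cases ?_ (fun j => ?_) i
  · simp
  · simp [Equiv.Perm.decomposeFin_symm_apply_succ]

lemma sum_dec {n : ℕ} {M : Type*} [AddCommMonoid M] (F : S (n + 1) → M) :
    ∑ g, F g = ∑ p, ∑ e, F (swap 0 p * io n e) := by
  rw [← Fintype.sum_prod_type', ← Equiv.sum_comp Equiv.Perm.decomposeFin.symm]
  refine Finset.sum_congr rfl fun x _ => ?_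
  rw [← dec_eq]

lemma sum_dec' {n : ℕ} {M : Type*} [AddCommMonoid M] (F : S (n + 1) → M) :
    ∑ g, F g = ∑ p, ∑ e, F (io n e * swap 0 p) := by
  rw [← Equiv.sum_comp (Equiv.inv _), sum_dec]
  refine Finset.sum_congr rfl fun p _ => ?_
  rw [← Equiv.sum_comp (Equiv.inv _)]
  refine Finset.sum_congr rfl fun e _ => ?_
  simp

lemma exists_io {n : ℕ} (g : S (n + 1)) (h : g 0 = 0) : ∃ e, g = io n e := by
  obtain ⟨⟨p, e⟩, rfl⟩ := Equiv.Perm.decomposeFin.symm.surjective g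
  rw [dec_eq] at *
  simp at h
  subst h
  exact ⟨e, by rw [show swap (0 : Fin (n+1)) 0 = 1 from swap_self 0, one_mul]⟩

lemma io_swap {n : ℕ} (i j : Fin n) : io n (swap i j) = swap i.succ j.succ := by
  ext x
  refine Fin.cases ?_ (fun y => ?_) x
  · rw [io_zero, swap_apply_of_ne_of_ne (Fin.succ_ne_zero _).symm (Fin.succ_ne_zero _).symm]
  · rw [io_succ, (Fin.succ_injective n).swap_apply]

lemma io_isSwap {n : ℕ} (e : S n) : (io n e).IsSwap ↔ e.IsSwap := by
  constructor
  · rintro ⟨x, y, hxy, h⟩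
    have hx0 : x ≠ 0 := by
      rintro rfl
      have := congrArg (fun g => g 0) h
      simp at this
      exact hxy this
    have hy0 : y ≠ 0 := by
      rintro rfl
      have := congrArg (fun g => g 0) h
      simp at this
      exact hxy this.symm
    obtain ⟨i, rfl⟩ := Fin.exists_succ_eq.2 hx0
    obtain ⟨j, rfl⟩ := Fin.exists_succ_eq.2 hy0
    rw [← io_swap] at h
    exact ⟨i, j, fun h => hxy (by rw [h]), io_inj h⟩
  · rintro ⟨x, y, hxy, rfl⟩
    exact ⟨x.succ, y.succ, fun h => hxy (Fin.succ_injective _ h), io_swap _ _⟩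

lemma isSwap_conj {n : ℕ} (g h : S n) (hg : g.IsSwap) : (h * g * h⁻¹).IsSwap := by
  obtain ⟨x, y, hxy, rfl⟩ := hg
  refine ⟨h x, h y, fun e => hxy (h.injective e), ?_⟩
  rw [Equiv.mul_swap_eq_swap_mul]; simp

open Classical in
/-- swap indicator -/
noncomputable def sw (n : ℕ) (g : S n) : ℂ := if g.IsSwap then 1 else 0

lemma sw_class (n : ℕ) : IsClass (sw n) := by
  intro g h
  unfold sw
  have : (h * g * h⁻¹).IsSwap ↔ g.IsSwap := by
    constructor
    · intro H
      have := isSwap_conj _ h⁻¹ H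
      simpa [mul_assoc] using this
    · exact isSwap_conj g h
  by_cases hg : g.IsSwap <;> simp [this, hg]

lemma sw_inv (n : ℕ) (g : S n) : sw n g⁻¹ = sw n g := by
  unfold sw
  have : ∀ g : S n, g.IsSwap → (g⁻¹).IsSwap := by
    rintro _ ⟨x, y, hxy, rfl⟩
    exact ⟨x, y, hxy, by simp⟩
  have : (g⁻¹).IsSwap ↔ g.IsSwap := ⟨fun h => by simpa using this _ h, this g⟩
  by_cases hg : g.IsSwap <;> simp [this, hg]

lemma sum_sw {n : ℕ} {M : Type*} [AddCommGroup M] [Module ℂ M] (F : S (n + 1) → M) :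
    ∑ g, sw (n + 1) g • F g = ∑ i : Fin n, F (swap 0 i.succ) + ∑ e, sw n e • F (io n e) := by
  classical
  rw [sum_dec, Fin.sum_univ_succ, add_comm]
  congr 1
  · refine Finset.sum_congr rfl fun i _ => ?_
    rw [Finset.sum_eq_single 1]
    · have : (swap (0 : Fin (n+1)) i.succ).IsSwap := ⟨_, _, (Fin.succ_ne_zero _).symm, rfl⟩
      simp [sw, this]
    · intro e _ he
      have : ¬ (swap 0 i.succ * io n e).IsSwap := by
        rintro ⟨x, y, hxy, h⟩
        apply he
        have h0 : swap x y 0 = i.succ := by rw [← h]; simp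
        have h1 : swap x y = swap 0 i.succ := by
          by_cases hx : x = 0
          · subst hx; simp at h0; rw [h0]
          · by_cases hy : y = 0
            · subst hy; simp at h0; rw [h0, swap_comm]
            · rw [swap_apply_of_ne_of_ne (Ne.symm hx) (Ne.symm hy)] at h0
              exact absurd h0.symm (Fin.succ_ne_zero _)
        rw [h1] at h
        have : io n e = 1 := mul_left_cancel (a := swap 0 i.succ) (by rw [h, mul_one])
        exact io_inj (by rw [this, map_one])
      simp [sw, this]
    · simp
  · refine Finset.sum_congr rfl fun e _ => ?_
    rw [show swap (0 : Fin (n+1)) 0 = 1 from swap_self 0, one_mul]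
    simp [sw, io_isSwap]

section rep
variable {n : ℕ} {V : Type} [AddCommGroup V] [Module ℂ V] [FiniteDimensional ℂ V]

/-- sum of transpositions -/
noncomputable def TT (ρ : Representation ℂ (S n) V) : Module.End ℂ V := ∑ g, sw n g • ρ g

/-- Jucys-Murphy -/
noncomputable def XX (ρ : Representation ℂ (S (n + 1)) V) : Module.End ℂ V :=
  ∑ i : Fin n, ρ (swap 0 i.succ)

/-- restriction -/
def rs (ρ : Representation ℂ (S (n + 1)) V) : Representation ℂ (S n) V := ρ.comp (io n)

@[simp] lemma rs_apply (ρ : Representation ℂ (S (n + 1)) V) (g : S n) : rs ρ g = ρ (io n g) := rfl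

/-- character ratio -/
noncomputable def tt (χ : S n → ℂ) : ℂ := (∑ g, sw n g * χ g) / χ 1

lemma TT_eq (ρ : Representation ℂ (S (n + 1)) V) : TT ρ = XX ρ + TT (rs ρ) := sum_sw _

lemma TT_irr (ρ : Representation ℂ (S n) V) [ρ.IsIrreducible] : TT ρ = tt ρ.character • 1 := by
  have h1 : TT ρ = ∑ y, sw n y • ρ y⁻¹ := by
    unfold TT
    apply Fintype.sum_equiv (Equiv.inv _)
    intro x
    simp [sw_inv]
  have h2 := scalar_of_commute' ρ (TT ρ) (by
    intro g
    rw [h1]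
    exact class_commute ρ (sw_class n) g)
  rw [h2]
  congr 1
  unfold tt TT
  rw [ρ.char_one]
  simp [Representation.character]

lemma XX_comm (ρ : Representation ℂ (S (n + 1)) V) (g : S n) :
    XX ρ * ρ (io n g) = ρ (io n g) * XX ρ := by
  unfold XX
  rw [Finset.sum_mul, Finset.mul_sum]
  apply Fintype.sum_equiv (g⁻¹ : S n)
  intro i
  rw [← map_mul, ← map_mul, Equiv.mul_swap_eq_swap_mul]
  simp

end rep
end MVC
set_option linter.unusedSectionVars false
namespace MVC
open Representation Equiv

section rep
variable {n : ℕ} {V : Type} [AddCommGroup V] [Module ℂ V] [FiniteDimensional ℂ V]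

/-- orbit sum -/
noncomputable def EE (ρ : Representation ℂ (S (n + 1)) V) (h : S (n + 1)) : Module.End ℂ V :=
  ∑ x, ρ (io n x * h * (io n x)⁻¹)

lemma EE_conj (ρ : Representation ℂ (S (n + 1)) V) (h : S (n + 1)) (y : S n) :
    EE ρ (io n y * h * (io n y)⁻¹) = EE ρ h := by
  unfold EE
  apply Fintype.sum_equiv (Equiv.mulRight y)
  intro x
  simp [mul_assoc]

lemma EE_conj' (ρ : Representation ℂ (S (n + 1)) V) {h h' : S (n + 1)} (y : S (n + 1))
    (hy : y 0 = 0) (e : y * h = h' * y) : EE ρ h' = EE ρ h := by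
  obtain ⟨z, rfl⟩ := exists_io y hy
  rw [← EE_conj ρ h z, e]
  simp

lemma XX_EE (ρ : Representation ℂ (S (n + 1)) V) (h : S (n + 1)) :
    XX ρ * EE ρ h = ∑ i : Fin n, EE ρ (swap 0 i.succ * h) := by
  unfold EE
  rw [Finset.sum_comm, Finset.mul_sum]
  refine Finset.sum_congr rfl fun x _ => ?_
  simp only [map_mul]
  rw [← mul_assoc, ← mul_assoc, XX_comm]
  unfold XX
  simp only [Finset.sum_mul, Finset.mul_sum, mul_assoc]

/-- orbit sum acts as a scalar on an eigenspace -/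
def Sc (ρ : Representation ℂ (S (n + 1)) V) (b : ℂ) (h : S (n + 1)) : Prop :=
  ∃ c : ℂ, ∀ w, XX ρ w = b • w → EE ρ h w = c • w

lemma Sc_of_sum (ρ : Representation ℂ (S (n + 1)) V) (b : ℂ) (h : S (n + 1))
    {ι : Type} [Fintype ι] (k : ι) (M : ι → Module.End ℂ V) (p : ι → Prop) [DecidablePred p]
    (hk : p k) (h1 : ∀ i, p i → M i = EE ρ h)
    (h2 : ∀ i, ¬ p i → ∃ c : ℂ, ∀ w, XX ρ w = b • w → M i w = c • w)
    (h3 : ∃ c : ℂ, ∀ w, XX ρ w = b • w → (∑ i, M i) w = c • w) : Sc ρ b h := by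
  classical
  have h4 : ∀ i, ∃ c : ℂ, ∀ w, XX ρ w = b • w →
      M i w = (if p i then (1:ℂ) else 0) • EE ρ h w + c • w := by
    intro i
    by_cases hp : p i
    · exact ⟨0, fun w _ => by simp [hp, h1 i hp]⟩
    · obtain ⟨c, hc⟩ := h2 i hp
      exact ⟨c, fun w hw => by simp [hp, hc w hw]⟩
  choose c hc using h4
  obtain ⟨c0, hc0⟩ := h3
  set N : ℂ := ∑ i, (if p i then (1:ℂ) else 0) with hN
  have hN0 : N ≠ 0 := by
    rw [hN, Finset.sum_boole]
    have : 0 < (Finset.univ.filter p).card := Finset.card_pos.2 ⟨k, by simp [hk]⟩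
    exact_mod_cast this.ne'
  refine ⟨N⁻¹ * (c0 - ∑ i, c i), fun w hw => ?_⟩
  have := hc0 w hw
  rw [LinearMap.sum_apply, Finset.sum_congr rfl (fun i _ => hc i w hw), Finset.sum_add_distrib,
    ← Finset.sum_smul, ← Finset.sum_smul, ← hN] at this
  have h5 : N • EE ρ h w = (c0 - ∑ i, c i) • w := by
    rw [sub_smul, ← this]; abel
  rw [mul_smul, ← h5, smul_smul, inv_mul_cancel₀ hN0, one_smul]

lemma Sc_move (ρ : Representation ℂ (S (n + 1)) V) (b : ℂ) (h : S (n + 1))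
    (IH : ∀ h', h'.support.card < h.support.card → Sc ρ b h') (h0 : h 0 ≠ 0) : Sc ρ b h := by
  classical
  obtain ⟨c, hc⟩ : ∃ c, h c = 0 := ⟨h⁻¹ 0, by simp⟩
  have hc0 : c ≠ 0 := by rintro rfl; exact h0 hc
  obtain ⟨k, rfl⟩ := Fin.exists_succ_eq.2 hc0
  set c := k.succ with hcdef
  set h' := swap 0 c * h with hh'
  have hfc : h' c = c := by simp [hh', hc]
  have hss : ∀ x, h x = x → h' x = x := by
    intro x hx
    have hx0 : x ≠ 0 := by rintro rfl; exact h0 hx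
    have hxc : x ≠ c := by rintro rfl; exact hc0 (hx.symm.trans hc)
    simp [hh', hx, swap_apply_of_ne_of_ne hx0 hxc]
  have hcs : c ∈ h.support := by rw [Perm.mem_support, hc]; exact hc0.symm
  have hlt : ∀ g : S (n + 1), (∀ x, h x = x → g x = x) → g c = c →
      g.support.card < h.support.card := by
    intro g hg hgc
    apply Finset.card_lt_card
    rw [Finset.ssubset_iff_of_subset]
    · exact ⟨c, hcs, by simp [hgc]⟩
    · intro x hx
      rw [Perm.mem_support] at *
      exact fun H => hx (hg x H)
  have hsc' := IH h' (hlt h' hss hfc)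
  apply Sc_of_sum ρ b h k (fun i => EE ρ (swap 0 i.succ * h')) (fun i => h' i.succ = i.succ) hfc
  · intro i hi
    by_cases hic : i.succ = c
    · simp only [hic, hh']
      rw [← mul_assoc, swap_mul_self, one_mul]
    · symm
      have hcomm : swap i.succ c * h' = h' * swap i.succ c := by
        rw [Equiv.mul_swap_eq_swap_mul, hi, hfc]
      apply EE_conj' ρ (swap i.succ c)
      · exact swap_apply_of_ne_of_ne (Fin.succ_ne_zero _).symm (Fin.succ_ne_zero _).symm
      · have : h = swap 0 c * h' := by rw [hh', ← mul_assoc, swap_mul_self, one_mul]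
        have e2 : swap i.succ c * swap 0 i.succ = swap 0 c * swap i.succ c := by
          rw [Equiv.mul_swap_eq_swap_mul, swap_apply_left,
            swap_apply_of_ne_of_ne (Fin.succ_ne_zero _).symm hc0.symm]
        rw [← mul_assoc, e2, mul_assoc, hcomm, ← mul_assoc, ← this]
  · intro i hi
    apply IH
    have hi2 : h i.succ ≠ i.succ := fun H => hi (hss _ H)
    apply hlt
    · intro x hx
      have hx0 : x ≠ 0 := by rintro rfl; exact h0 hx
      have hxi : x ≠ i.succ := by rintro rfl; exact hi2 hx
      rw [Perm.mul_apply, hss x hx, swap_apply_of_ne_of_ne hx0 hxi]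
    · rw [Perm.mul_apply, hfc, swap_apply_of_ne_of_ne hc0]
      intro H
      exact hi (by rw [← H, hfc])
  · obtain ⟨c', hc'⟩ := hsc'
    refine ⟨c' * b, fun w hw => ?_⟩
    rw [← XX_EE, Module.End.mul_apply, hc' w hw, map_smul, hw, smul_smul]

lemma Sc_all (ρ : Representation ℂ (S (n + 1)) V) [ρ.IsIrreducible] (b : ℂ) :
    ∀ (N : ℕ) (h : S (n + 1)), h.support.card = N → Sc ρ b h := by
  classical
  intro N
  induction N using Nat.strong_induction_on with
  | _ N IH =>
  intro h hN
  have IH' : ∀ h', h'.support.card < N → Sc ρ b h' := fun h' hh => IH _ hh h' rfl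
  by_cases h0 : h 0 = 0
  swap
  · exact Sc_move ρ b h (by rw [hN]; exact IH') h0
  apply Sc_of_sum ρ b h (0 : Fin (n + 1)) (fun p => EE ρ (swap 0 p * h * swap 0 p))
    (fun p => h p = p) h0
  · intro p hp
    have : swap 0 p * h = h * swap 0 p := by
      rw [Equiv.mul_swap_eq_swap_mul, h0, hp]
    simp only [this]
    rw [mul_assoc, swap_mul_self, mul_one]
  · intro p hp
    have hp0 : p ≠ 0 := by rintro rfl; exact hp h0
    have hs : (swap 0 p * h * swap 0 p).support.card = N := by
      rw [← hN, ← Perm.card_support_conj (σ := swap 0 p) (τ := h), Equiv.swap_inv]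
    apply Sc_move
    · rw [hs]; exact IH'
    · rw [Perm.mul_apply, Perm.mul_apply, swap_apply_left]
      intro H
      have := congrArg (swap 0 p) H
      rw [swap_apply_self, swap_apply_left] at this
      exact hp this
  · have h1 : ∑ p, EE ρ (swap 0 p * h * swap 0 p) = ∑ y, ρ y * ρ h * ρ y⁻¹ := by
      rw [sum_dec']
      refine Finset.sum_congr rfl fun p _ => ?_
      unfold EE
      refine Finset.sum_congr rfl fun e _ => ?_
      simp [mul_assoc]
    rw [h1, sum_conj_eq]
    exact ⟨_, fun w _ => rfl⟩

lemma unique_sub (ρ : Representation ℂ (S (n + 1)) V) [ρ.IsIrreducible] (b : ℂ)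
    (U U' : Submodule ℂ V) (hU : ∀ g, ∀ w ∈ U, rs ρ g w ∈ U) (hU' : ∀ g, ∀ w ∈ U', rs ρ g w ∈ U')
    (hX : ∀ u ∈ U, XX ρ u = b • u) (hX' : ∀ u ∈ U', XX ρ u = b • u)
    (hne : U ≠ ⊥) (hne' : U' ≠ ⊥) : U = U' := by
  have key : ∀ (U : Submodule ℂ V) (hU : ∀ g, ∀ w ∈ U, rs ρ g w ∈ U)
    (hX : ∀ u ∈ U, XX ρ u = b • u) (hne : U ≠ ⊥), ∃ P : Module.End ℂ V,
      (∀ v, P v ∈ U) ∧ (∀ w ∈ U, P w = w) ∧ LinearMap.trace ℂ V P ≠ 0 ∧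
      ∀ h c, (∀ w, XX ρ w = b • w → EE ρ h w = c • w) →
        (Nat.card (S n) : ℂ) * LinearMap.trace ℂ V (P * ρ h) = c * LinearMap.trace ℂ V P := by
    intro U hU hX hne
    obtain ⟨P, hP1, hP2, hP3⟩ := exists_proj (rs ρ) U hU
    refine ⟨P, hP2, hP3, ?_, ?_⟩
    · have hp : LinearMap.IsProj U P := ⟨hP2, hP3⟩
      rw [hp.trace]
      have : 0 < Module.finrank ℂ U := by
        rw [Module.finrank_pos_iff_exists_ne_zero]
        obtain ⟨u, hu, hu0⟩ := Submodule.exists_mem_ne_zero_of_ne_bot hne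
        exact ⟨⟨u, hu⟩, fun h => hu0 (congrArg Subtype.val h)⟩
      exact_mod_cast this.ne'
    · intro h c hc
      have h1 : EE ρ h * P = c • P := by
        ext v
        simp [hc (P v) (hX _ (hP2 v))]
      have h2 : ∀ x : S n, LinearMap.trace ℂ V (ρ (io n x * h * (io n x)⁻¹) * P) =
          LinearMap.trace ℂ V (P * ρ h) := by
        intro x
        have e := hP1 x⁻¹
        simp only [rs_apply, map_inv] at e
        rw [map_mul ρ, map_mul ρ, mul_assoc, ← e, ← mul_assoc, LinearMap.trace_mul_comm,
          ← mul_assoc, ← mul_assoc, rho_inv_mul, one_mul, LinearMap.trace_mul_comm]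
      have h3 := congrArg (LinearMap.trace ℂ V) h1
      unfold EE at h3
      rw [Finset.sum_mul, map_sum, Finset.sum_congr rfl (fun x _ => h2 x)] at h3
      simpa using h3
  obtain ⟨P, hP1, hP2, hP3, hP4⟩ := key U hU hX hne
  obtain ⟨P', hP1', hP2', hP3', hP4'⟩ := key U' hU' hX' hne'
  set τ := LinearMap.trace ℂ V P
  set τ' := LinearMap.trace ℂ V P'
  have hM : τ' • P - τ • P' = 0 := by
    apply eq_zero_of_trace ρ
    intro h
    obtain ⟨c, hc⟩ := Sc_all ρ b _ h rfl
    have e1 := hP4 h c hc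
    have e2 := hP4' h c hc
    have hcard : (Nat.card (S n) : ℂ) ≠ 0 := by simp
    rw [sub_mul, map_sub, smul_mul_assoc, smul_mul_assoc, map_smul, map_smul, smul_eq_mul,
      smul_eq_mul]
    apply mul_left_cancel₀ hcard
    linear_combination τ' * e1 - τ * e2
  have hM' : ∀ v, τ' • P v = τ • P' v := by
    intro v
    have := LinearMap.congr_fun hM v
    simpa [sub_eq_zero] using this
  apply le_antisymm
  · intro u hu
    have := hM' u
    rw [hP2 u hu] at this
    rw [← inv_smul_smul₀ hP3' u, this]
    exact U'.smul_mem _ (U'.smul_mem _ (hP1' u))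
  · intro u hu
    have := hM' u
    rw [hP2' u hu] at this
    rw [← inv_smul_smul₀ hP3 u, ← this]
    exact U.smul_mem _ (U.smul_mem _ (hP1 u))

end rep
end MVC
set_option linter.unusedSectionVars false
namespace MVC
open Representation Equiv

section gen
variable {G V W : Type} [Group G] [Fintype G] [AddCommGroup V] [Module ℂ V] [FiniteDimensional ℂ V]
  [AddCommGroup W] [Module ℂ W] [FiniteDimensional ℂ W]

lemma inn_finrank (σ : Representation ℂ G V) (τ : Representation ℂ G W) :
    inn σ.character τ.character = Module.finrank ℂ (IntertwiningMap τ σ) := by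
  have : Invertible (Nat.card G : ℂ) := invertibleOfNonzero (by simp)
  have := card_inv_mul_sum_char_mul_char_eq_finrank τ σ
  unfold inn
  exact_mod_cast this

lemma int_comm {σ : Representation ℂ G V} {τ : Representation ℂ G W} (f : IntertwiningMap τ σ)
    (g : G) (w : W) : f (τ g w) = σ g (f w) := IntertwiningMap.isIntertwining τ σ f g w

lemma child_sub (σ : Representation ℂ G V) {ψ : G → ℂ} (hψ : IsIrr ψ)
    (h : inn σ.character ψ ≠ 0) : ∃ (U : Submodule ℂ V) (hU : ∀ g, ∀ w ∈ U, σ g w ∈ U),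
      (sub σ U hU).IsIrreducible ∧ (sub σ U hU).character = ψ := by
  obtain ⟨W, _, _, _, τ, hτ, rfl⟩ := hψ
  rw [inn_finrank] at h
  have h' : 0 < Module.finrank ℂ (IntertwiningMap τ σ) := by
    rw [Nat.pos_iff_ne_zero]; exact_mod_cast h
  obtain ⟨f, hf⟩ := Module.finrank_pos_iff_exists_ne_zero.1 h'
  have hinj := (IsIrreducible.injective_or_eq_zero f).resolve_right hf
  obtain ⟨w0, hw0⟩ := exists_ne_zero_of_irr τ
  obtain ⟨U, hUle, hU, hirr⟩ := exists_irr_sub σ (LinearMap.range f.toLinearMap) (by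
    rintro g _ ⟨w, rfl⟩
    exact ⟨τ g w, int_comm f g w⟩) (by
    intro hb
    have : f w0 ∈ LinearMap.range f.toLinearMap := ⟨w0, rfl⟩
    rw [hb, Submodule.mem_bot] at this
    exact hw0 (hinj (by rw [this, map_zero])))
  refine ⟨U, hU, hirr, ?_⟩
  let T : Subrepresentation τ := ⟨U.comap f.toLinearMap, by
    intro g w hw
    have hw' : f w ∈ U := hw
    change f (τ g w) ∈ U
    rw [int_comm]
    exact hU _ _ hw'⟩
  have hT : ∀ w, f w ∈ U := by
    rcases eq_bot_or_eq_top T with hb | ht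
    · exfalso
      obtain ⟨⟨u, hu⟩, hu0⟩ := exists_ne_zero_of_irr (sub σ U hU)
      obtain ⟨w, hw⟩ := hUle hu
      have h1 : w ∈ T.toSubmodule := by
        change f.toLinearMap w ∈ U
        rw [hw]; exact hu
      rw [hb] at h1
      have h2 : w = 0 := by simpa using (show w ∈ (⊥ : Submodule ℂ W) from h1)
      apply hu0
      apply Subtype.ext
      have h3 : u = 0 := by rw [← hw, h2, map_zero]
      exact h3
    · intro w
      have : w ∈ T.toSubmodule := by rw [ht]; exact Submodule.mem_top (R := ℂ)
      exact this
  let f' : IntertwiningMap τ (sub σ U hU) := ⟨LinearMap.codRestrict U f.toLinearMap hT, by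
    intro g; ext w; exact int_comm f g w⟩
  have hf' : f' ≠ 0 := by
    intro h0
    apply hw0
    apply hinj
    rw [map_zero]
    have : f' w0 = 0 := by rw [h0]; rfl
    exact congrArg Subtype.val this
  have hbij := (IsIrreducible.bijective_or_eq_zero f').resolve_right hf'
  exact (char_iso (IntertwiningMap.ofBijective f' hbij)).symm

lemma sub_child (σ : Representation ℂ G V) (U : Submodule ℂ V) (hU : ∀ g, ∀ w ∈ U, σ g w ∈ U)
    [(sub σ U hU).IsIrreducible] : inn σ.character (sub σ U hU).character ≠ 0 := by
  rw [inn_finrank]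
  let f : IntertwiningMap (sub σ U hU) σ := ⟨U.subtype, by intro g; ext w; rfl⟩
  obtain ⟨u, hu⟩ := exists_ne_zero_of_irr (sub σ U hU)
  have : 0 < Module.finrank ℂ (IntertwiningMap (sub σ U hU) σ) := by
    rw [Module.finrank_pos_iff_exists_ne_zero]
    refine ⟨f, fun h => hu ?_⟩
    have : f u = 0 := by rw [h]; rfl
    exact Subtype.ext this
  exact_mod_cast this.ne'

lemma scalar_of_inn (σ : Representation ℂ G V) (h : inn σ.character σ.character = 1)
    (M : Module.End ℂ V) (hM : ∀ g, M * σ g = σ g * M) : ∃ c : ℂ, M = c • 1 := by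
  rw [inn_finrank] at h
  have h' : Module.finrank ℂ (IntertwiningMap σ σ) = 1 := by exact_mod_cast h
  have hne : (IntertwiningMap.id σ) ≠ 0 := by
    intro h0
    have hz : ∀ f : IntertwiningMap σ σ, f = 0 := by
      intro f
      ext v
      have : v = 0 := by
        have := congrArg (fun f : IntertwiningMap σ σ => f v) h0
        exact this
      subst this
      simp
    have : Subsingleton (IntertwiningMap σ σ) := ⟨fun a b => by rw [hz a, hz b]⟩
    rw [Module.finrank_zero_of_subsingleton] at h'
    omega
  obtain ⟨c, hc⟩ := (finrank_eq_one_iff_of_nonzero' _ hne).1 h' ⟨M, hM⟩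
  exact ⟨c, (congrArg IntertwiningMap.toLinearMap hc).symm⟩

end gen

section sym
variable {n : ℕ}

/-- restriction of functions -/
def res (χ : S (n + 1) → ℂ) : S n → ℂ := fun g => χ (io n g)

open Classical in
/-- children -/
noncomputable def ch (χ : S (n + 1) → ℂ) : Finset (S n → ℂ) :=
  (irr (S n)).filter fun ψ => inn (res χ) ψ ≠ 0

lemma mem_ch {χ : S (n + 1) → ℂ} {ψ : S n → ℂ} : ψ ∈ ch χ ↔ IsIrr ψ ∧ inn (res χ) ψ ≠ 0 := by
  simp [ch, mem_irr]

variable {V : Type} [AddCommGroup V] [Module ℂ V] [FiniteDimensional ℂ V]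

lemma res_char (ρ : Representation ℂ (S (n + 1)) V) : res ρ.character = (rs ρ).character := rfl

lemma XX_of_TT (ρ : Representation ℂ (S (n + 1)) V) [ρ.IsIrreducible] (v : V) :
    XX ρ v = tt ρ.character • v - TT (rs ρ) v := by
  have h1 := TT_eq ρ
  rw [TT_irr ρ] at h1
  have := LinearMap.congr_fun h1 v
  simp only [LinearMap.smul_apply, Module.End.one_apply, LinearMap.add_apply] at this
  rw [this]; abel

lemma XX_of_int {W : Type} [AddCommGroup W] [Module ℂ W] [FiniteDimensional ℂ W]
    (ρ : Representation ℂ (S (n + 1)) V) [ρ.IsIrreducible]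
    (τ : Representation ℂ (S n) W) [τ.IsIrreducible] (f : IntertwiningMap τ (rs ρ)) (w : W) :
    XX ρ (f w) = (tt ρ.character - tt τ.character) • f w := by
  rw [XX_of_TT, sub_smul]
  congr 1
  have h1 : TT τ w = tt τ.character • w := by rw [TT_irr]; rfl
  rw [← map_smul, ← h1]
  unfold TT
  rw [LinearMap.sum_apply, LinearMap.sum_apply, map_sum]
  refine Finset.sum_congr rfl fun g _ => ?_
  rw [LinearMap.smul_apply, LinearMap.smul_apply, map_smul, int_comm]

/-- inclusion -/
def incl (ρ : Representation ℂ (S (n + 1)) V) (U : Submodule ℂ V)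
    (hU : ∀ g, ∀ w ∈ U, rs ρ g w ∈ U) : IntertwiningMap (sub (rs ρ) U hU) (rs ρ) :=
  ⟨U.subtype, by intro g; ext w; rfl⟩

lemma XX_sub (ρ : Representation ℂ (S (n + 1)) V) [ρ.IsIrreducible] (U : Submodule ℂ V)
    (hU : ∀ g, ∀ w ∈ U, rs ρ g w ∈ U) [(sub (rs ρ) U hU).IsIrreducible] (u : V) (hu : u ∈ U) :
    XX ρ u = (tt ρ.character - tt (sub (rs ρ) U hU).character) • u :=
  XX_of_int ρ (sub (rs ρ) U hU) (incl ρ U hU) ⟨u, hu⟩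

lemma mult_le (ρ : Representation ℂ (S (n + 1)) V) [ρ.IsIrreducible]
    {W : Type} [AddCommGroup W] [Module ℂ W] [FiniteDimensional ℂ W]
    (τ : Representation ℂ (S n) W) [τ.IsIrreducible] :
    Module.finrank ℂ (IntertwiningMap τ (rs ρ)) ≤ 1 := by
  by_cases hz : ∃ f : IntertwiningMap τ (rs ρ), f ≠ 0
  swap
  · push Not at hz
    have : Subsingleton (IntertwiningMap τ (rs ρ)) := ⟨fun a b => by rw [hz a, hz b]⟩
    rw [Module.finrank_zero_of_subsingleton]; omega
  obtain ⟨w0, hw0⟩ := exists_ne_zero_of_irr τ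
  have hinv : ∀ f : IntertwiningMap τ (rs ρ), ∀ g, ∀ w ∈ LinearMap.range f.toLinearMap,
      rs ρ g w ∈ LinearMap.range f.toLinearMap := by
    rintro f g _ ⟨w, rfl⟩
    exact ⟨τ g w, int_comm f g w⟩
  have hX : ∀ f : IntertwiningMap τ (rs ρ), ∀ u ∈ LinearMap.range f.toLinearMap,
      XX ρ u = (tt ρ.character - tt τ.character) • u := by
    rintro f _ ⟨w, rfl⟩
    exact XX_of_int ρ τ f w
  have hnb : ∀ f : IntertwiningMap τ (rs ρ), f ≠ 0 → LinearMap.range f.toLinearMap ≠ ⊥ := by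
    intro f hf hb
    have hinj := (IsIrreducible.injective_or_eq_zero f).resolve_right hf
    have : f w0 ∈ LinearMap.range f.toLinearMap := ⟨w0, rfl⟩
    rw [hb, Submodule.mem_bot] at this
    exact hw0 (hinj (by rw [this, map_zero]))
  obtain ⟨f, hf⟩ := hz
  have hinj := (IsIrreducible.injective_or_eq_zero f).resolve_right hf
  apply finrank_le_one f
  intro g
  by_cases hg : g = 0
  · exact ⟨0, by rw [hg, zero_smul]⟩
  have heq := unique_sub ρ _ _ _ (hinv f) (hinv g) (hX f) (hX g) (hnb f hf) (hnb g hg)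
  have hgr : ∀ w, ∃ w', f w' = g w := by
    intro w
    have : g w ∈ LinearMap.range f.toLinearMap := by rw [heq]; exact ⟨w, rfl⟩
    exact this
  choose m hm using hgr
  let M : Module.End ℂ W :=
    { toFun := m
      map_add' := by intro x y; apply hinj; simp [hm]
      map_smul' := by intro c x; apply hinj; simp [hm] }
  obtain ⟨c, hc⟩ := scalar_of_commute τ M (by
    intro a
    ext w
    apply hinj
    change f (m (τ a w)) = f (τ a (m w))
    rw [hm, int_comm, int_comm, hm])
  refine ⟨c, ?_⟩
  ext w
  have : m w = c • w := LinearMap.congr_fun hc w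
  change c • f w = g w
  rw [← hm w, this, map_smul]

lemma mult_eq {χ : S (n + 1) → ℂ} (hχ : IsIrr χ) {ψ : S n → ℂ} (hψ : IsIrr ψ) :
    inn (res χ) ψ = 0 ∨ inn (res χ) ψ = 1 := by
  obtain ⟨V, _, _, _, ρ, hρ, rfl⟩ := hχ
  obtain ⟨W, _, _, _, τ, hτ, rfl⟩ := hψ
  rw [res_char, inn_finrank]
  have := mult_le ρ τ
  interval_cases Module.finrank ℂ (IntertwiningMap τ (rs ρ)) <;> simp

lemma mult_ch {χ : S (n + 1) → ℂ} (hχ : IsIrr χ) {ψ : S n → ℂ} (h : ψ ∈ ch χ) :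
    inn (res χ) ψ = 1 := by
  rw [mem_ch] at h
  exact (mult_eq hχ h.1).resolve_left h.2

lemma tt_inj {χ : S (n + 1) → ℂ} (hχ : IsIrr χ) {ψ ψ' : S n → ℂ} (h : ψ ∈ ch χ) (h' : ψ' ∈ ch χ)
    (e : tt ψ = tt ψ') : ψ = ψ' := by
  rw [mem_ch] at h h'
  obtain ⟨V, _, _, _, ρ, hρ, rfl⟩ := hχ
  obtain ⟨U, hU, hirr, rfl⟩ := child_sub (rs ρ) h.1 h.2
  obtain ⟨U', hU', hirr', rfl⟩ := child_sub (rs ρ) h'.1 h'.2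
  have hne : ∀ (U : Submodule ℂ V) (hU : ∀ g, ∀ w ∈ U, rs ρ g w ∈ U)
      (_ : (sub (rs ρ) U hU).IsIrreducible), U ≠ ⊥ := by
    intro U hU hirr hb
    obtain ⟨⟨u, hu⟩, hu0⟩ := exists_ne_zero_of_irr (sub (rs ρ) U hU)
    apply hu0
    rw [hb, Submodule.mem_bot] at hu
    exact Subtype.ext hu
  have := unique_sub ρ _ U U' hU hU' (XX_sub ρ U hU) (by rw [e]; exact XX_sub ρ U' hU')
    (hne U hU hirr) (hne U' hU' hirr')
  subst this
  rfl

lemma res_class {χ : S (n + 1) → ℂ} (h : IsClass χ) : IsClass (res χ) := by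
  intro a b
  simp only [res, map_mul, map_inv]
  exact h _ _

lemma res_eq {χ : S (n + 1) → ℂ} (hχ : IsIrr χ) (g : S n) : res χ g = ∑ ψ ∈ ch χ, ψ g := by
  classical
  rw [expand (res_class hχ.isClass) g, ch, Finset.sum_filter]
  refine Finset.sum_congr rfl fun ψ hψ => ?_
  rcases mult_eq hχ (mem_irr.1 hψ) with h | h <;> simp [h]

lemma dg_eq {χ : S (n + 1) → ℂ} (hχ : IsIrr χ) : dg χ = ∑ ψ ∈ ch χ, dg ψ := by
  have := congrArg Complex.re (res_eq hχ 1)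
  simpa [res, dg] using this

lemma inn_res_self {χ : S (n + 1) → ℂ} (hχ : IsIrr χ) : inn (res χ) (res χ) = (ch χ).card := by
  classical
  rw [inn_expand (res_class hχ.isClass), Finset.card_eq_sum_ones, Nat.cast_sum, ch,
    Finset.sum_filter]
  refine Finset.sum_congr rfl fun ψ hψ => ?_
  rw [inn_comm ψ]
  rcases mult_eq hχ (mem_irr.1 hψ) with h | h <;> simp [h]

lemma ch_of_eigen (ρ : Representation ℂ (S (n + 1)) V) [ρ.IsIrreducible] (b : ℂ) (u : V)
    (hu : u ≠ 0) (hX : XX ρ u = b • u) :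
    ∃ ψ ∈ ch ρ.character, tt ρ.character - tt ψ = b := by
  let K : Submodule ℂ V := LinearMap.ker (XX ρ - b • 1)
  have hK : ∀ v, v ∈ K ↔ XX ρ v = b • v := by
    intro v
    simp [K, LinearMap.mem_ker, sub_eq_zero]
  obtain ⟨U, hUle, hU, hirr⟩ := exists_irr_sub (rs ρ) K (by
    intro g w hw
    rw [hK] at *
    have := LinearMap.congr_fun (XX_comm ρ g) w
    simp only [Module.End.mul_apply] at this
    rw [rs_apply, this, hw, map_smul]) (by
    intro hb
    have := (hK u).2 hX
    rw [hb, Submodule.mem_bot] at this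
    exact hu this)
  refine ⟨(sub (rs ρ) U hU).character, mem_ch.2 ⟨⟨_, _, _, inferInstance, _, hirr, rfl⟩, ?_⟩, ?_⟩
  · exact sub_child (rs ρ) U hU
  · obtain ⟨⟨v, hv⟩, hv0⟩ := exists_ne_zero_of_irr (sub (rs ρ) U hU)
    have h1 := XX_sub ρ U hU v hv
    rw [(hK v).1 (hUle hv)] at h1
    have : v ≠ 0 := fun h => hv0 (Subtype.ext h)
    exact (smul_left_injective ℂ this h1).symm

end sym
end MVC
set_option linter.unusedSectionVars false
namespace MVC
open Representation Equiv

section loc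
variable {n : ℕ} {V : Type} [AddCommGroup V] [Module ℂ V] [FiniteDimensional ℂ V]

lemma XXs (ρ : Representation ℂ (S (n + 2)) V) :
    XX ρ * ρ (swap 0 1) = 1 + ρ (swap 0 1) * XX (rs ρ) := by
  unfold XX
  rw [Fin.sum_univ_succ, add_mul, Finset.sum_mul, Finset.mul_sum, ← map_mul]
  congr 1
  · rw [show (0 : Fin (n+1)).succ = 1 from rfl, swap_mul_self, map_one]
  · refine Finset.sum_congr rfl fun i _ => ?_
    rw [rs_apply, ← map_mul, ← map_mul, io_swap, Equiv.mul_swap_eq_swap_mul (swap 0 1)]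
    congr 3

lemma loc_vec (ρ : Representation ℂ (S (n + 2)) V) [ρ.IsIrreducible] {ψ : S (n + 1) → ℂ}
    {φ : S n → ℂ} (hψ : ψ ∈ ch ρ.character) (hφ : φ ∈ ch ψ) :
    ∃ v : V, v ≠ 0 ∧ XX ρ v = (tt ρ.character - tt ψ) • v ∧ XX (rs ρ) v = (tt ψ - tt φ) • v := by
  rw [mem_ch] at hψ
  obtain ⟨U, hU, hirr, rfl⟩ := child_sub (rs ρ) hψ.1 hψ.2
  rw [mem_ch] at hφ
  obtain ⟨U', hU', hirr', rfl⟩ := child_sub (rs (sub (rs ρ) U hU)) hφ.1 hφ.2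
  obtain ⟨⟨u, hu⟩, hu0⟩ := exists_ne_zero_of_irr (sub (rs (sub (rs ρ) U hU)) U' hU')
  refine ⟨u.1, ?_, XX_sub ρ U hU u.1 u.2, ?_⟩
  · intro h
    exact hu0 (Subtype.ext (Subtype.ext h))
  · have := congrArg Subtype.val (XX_sub (sub (rs ρ) U hU) U' hU' u hu)
    rw [Submodule.coe_smul] at this
    rw [← this]
    unfold XX
    rw [LinearMap.sum_apply, LinearMap.sum_apply]
    simp only [AddSubmonoidClass.coe_finsetSum]
    rfl

lemma loc_ne (ρ : Representation ℂ (S (n + 2)) V) [ρ.IsIrreducible] (a : ℂ) (v : V) (hv : v ≠ 0)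
    (h1 : XX ρ v = a • v) (h2 : XX (rs ρ) v = a • v) : False := by
  set s := ρ (swap 0 1) with hs
  have h3 : XX ρ (s v) = v + a • s v := by
    have := LinearMap.congr_fun (XXs ρ) v
    simp only [Module.End.mul_apply, LinearMap.add_apply, Module.End.one_apply, h2, map_smul]
      at this
    exact this
  let K : Submodule ℂ V := LinearMap.ker (XX ρ - a • 1)
  have hK : ∀ v, v ∈ K ↔ XX ρ v = a • v := by
    intro v
    simp [K, LinearMap.mem_ker, sub_eq_zero]
  obtain ⟨P, hP, hP1, hP2⟩ := exists_proj (rs ρ) K (by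
    intro g w hw
    rw [hK] at *
    have := LinearMap.congr_fun (XX_comm ρ g) w
    simp only [Module.End.mul_apply] at this
    rw [rs_apply, this, hw, map_smul])
  have hPX : ∀ w, P (XX ρ w) = XX ρ (P w) := by
    intro w
    rw [XX_of_TT, XX_of_TT, map_sub, map_smul]
    congr 1
    unfold TT
    rw [LinearMap.sum_apply, LinearMap.sum_apply, map_sum]
    refine Finset.sum_congr rfl fun g _ => ?_
    rw [LinearMap.smul_apply, LinearMap.smul_apply, map_smul]
    congr 1
    exact LinearMap.congr_fun (hP g) w
  have h4 := hPX (s v)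
  rw [h3, map_add, hP2 v ((hK v).2 h1), map_smul, (hK _).1 (hP1 _)] at h4
  exact hv (by simpa using h4)

lemma loc_main {χ : S (n + 2) → ℂ} (hχ : IsIrr χ) {ψ : S (n + 1) → ℂ}
    {φ : S n → ℂ} (hψ : ψ ∈ ch χ) (hφ : φ ∈ ch ψ) :
    tt χ - tt ψ ≠ tt ψ - tt φ ∧ ((tt χ - tt ψ - (tt ψ - tt φ))^2 ≠ 1 →
      ∃ ψ' ∈ ch χ, tt χ - tt ψ' = tt ψ - tt φ) := by
  obtain ⟨V, _, _, _, ρ, hρ, rfl⟩ := hχ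
  obtain ⟨v, hv, h1, h2⟩ := loc_vec ρ hψ hφ
  set a := tt ρ.character - tt ψ
  set b := tt ψ - tt φ
  have hab : a ≠ b := by
    intro h
    rw [← h] at h2
    exact loc_ne ρ a v hv h1 h2
  refine ⟨hab, fun hne => ?_⟩
  have hab' : a - b ≠ 0 := sub_ne_zero.2 hab
  set s := ρ (swap 0 1) with hs
  have h3 : XX ρ (s v) = v + b • s v := by
    have := LinearMap.congr_fun (XXs ρ) v
    simp only [Module.End.mul_apply, LinearMap.add_apply, Module.End.one_apply, h2, map_smul]
      at this
    exact this
  have hss : s (s v) = v := by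
    have : s * s = 1 := by rw [hs, ← map_mul, swap_mul_self, map_one]
    exact LinearMap.congr_fun this v
  apply ch_of_eigen ρ b (s v - (a - b)⁻¹ • v)
  · intro h0
    rw [sub_eq_zero] at h0
    have h5 : v = ((a-b)⁻¹ * (a-b)⁻¹) • v := by
      conv_lhs => rw [← hss, h0, map_smul, h0, smul_smul]
    have h6 : (1 - ((a-b)⁻¹ * (a-b)⁻¹)) • v = 0 := by
      rw [sub_smul, one_smul, ← h5, sub_self]
    rcases smul_eq_zero.1 h6 with h7 | h7
    · apply hne
      field_simp at h7
      linear_combination h7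
    · exact hv h7
  · rw [map_sub, map_smul, h3, h1, smul_sub, smul_smul, smul_smul]
    have : v = ((a-b)⁻¹ * (a - b)) • v := by rw [inv_mul_cancel₀ hab', one_smul]
    have h8 : v - ((a-b)⁻¹ * a) • v = - ((b * (a-b)⁻¹) • v) := by
      conv_lhs => lhs; rw [this]
      rw [← sub_smul, ← neg_smul]
      congr 1
      ring
    rw [add_sub_right_comm, h8]
    abel

lemma card_le {χ : S (n + 2) → ℂ} (hχ : IsIrr χ) {ψ : S (n + 1) → ℂ} (hψ : ψ ∈ ch χ) :
    (ch ψ).card ≤ (ch χ).card + 1 := by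
  classical
  have hψi := (mem_ch.1 hψ).1
  set a := tt χ - tt ψ with ha
  have hinj : Set.InjOn (fun φ : S n → ℂ => tt ψ - tt φ) (ch ψ) := by
    intro φ h φ' h' e
    exact tt_inj hψi h h' (by simpa using e)
  have hinj2 : Set.InjOn (fun φ : S (n+1) → ℂ => tt χ - tt φ) (ch χ) := by
    intro φ h φ' h' e
    exact tt_inj hχ h h' (by simpa using e)
  rw [← Finset.card_image_of_injOn hinj, ← Finset.card_image_of_injOn hinj2]
  have hsub : (ch ψ).image (fun φ : S n → ℂ => tt ψ - tt φ) ⊆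
      (((ch χ).image (fun φ => tt χ - tt φ)).erase a) ∪ {a - 1, a + 1} := by
    intro b hb
    obtain ⟨φ, hφ, rfl⟩ := Finset.mem_image.1 hb
    obtain ⟨h1, h2⟩ := loc_main hχ hψ hφ
    rw [Finset.mem_union, Finset.mem_erase]
    by_cases h : (tt χ - tt ψ - (tt ψ - tt φ))^2 = 1
    · right
      rw [sq] at h
      rcases mul_self_eq_one_iff.1 h with h | h
      · simp only [Finset.mem_insert, Finset.mem_singleton]
        left; linear_combination -h
      · simp only [Finset.mem_insert, Finset.mem_singleton]
        right; linear_combination -h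
    · left
      obtain ⟨ψ', h3, h4⟩ := h2 h
      exact ⟨h1.symm, Finset.mem_image.2 ⟨ψ', h3, h4⟩⟩
  have h1 := Finset.card_le_card hsub
  have h2 := Finset.card_union_le (((ch χ).image (fun φ => tt χ - tt φ)).erase a) {a - 1, a + 1}
  have h3 : ({a - 1, a + 1} : Finset ℂ).card ≤ 2 := Finset.card_le_two
  have h4 : a ∈ (ch χ).image (fun φ => tt χ - tt φ) := Finset.mem_image.2 ⟨ψ, hψ, rfl⟩
  have h5 := Finset.card_erase_add_one h4
  omega

lemma ch_one {χ : S (n + 1) → ℂ} (hχ : IsIrr χ) (h : (ch χ).card = 1) :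
    ∃ ψ, ch χ = {ψ} ∧ IsIrr ψ ∧ res χ = ψ := by
  obtain ⟨ψ, hψ⟩ := Finset.card_eq_one.1 h
  refine ⟨ψ, hψ, ?_, ?_⟩
  · exact (mem_ch.1 (by rw [hψ]; simp : ψ ∈ ch χ)).1
  · ext g; rw [res_eq hχ, hψ, Finset.sum_singleton]

lemma swap_conj_zero {n : ℕ} {g : S (n + 2)} (hg : g.IsSwap) :
    ∃ h : S (n + 2), g = h * swap 0 1 * h⁻¹ := by
  have hs : (swap (0 : Fin (n+2)) 1).IsSwap := ⟨0, 1, by simp, rfl⟩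
  have : IsConj (swap (0 : Fin (n+2)) 1) g := by
    rw [Equiv.Perm.isConj_iff_cycleType_eq]
    rw [Equiv.Perm.isSwap_iff_cycleType.1 hg, Equiv.Perm.isSwap_iff_cycleType.1 hs]
  obtain ⟨h, hh⟩ := isConj_iff.1 this
  exact ⟨h, hh.symm⟩

lemma dg_one_of {χ : S (n + 2) → ℂ} (hχ : IsIrr χ) {ψ : S (n + 1) → ℂ} (hψ : ψ ∈ ch χ)
    (h1 : (ch χ).card = 1) (h2 : (ch ψ).card = 1) : dg χ = 1 := by
  obtain ⟨ψ', e, hi, hr⟩ := ch_one hχ h1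
  rw [e, Finset.mem_singleton] at hψ
  subst hψ
  obtain ⟨φ, e', hi', hr'⟩ := ch_one hi h2
  obtain ⟨V, _, _, _, ρ, hρ, rfl⟩ := hχ
  have hc : (rs (rs ρ)).character = φ := by
    rw [← hr', ← hr]; rfl
  obtain ⟨c, hcs⟩ := scalar_of_inn (rs (rs ρ)) (by rw [hc]; exact hi'.inn_self) (ρ (swap 0 1)) (by
    intro g
    rw [rs_apply, rs_apply, ← map_mul, ← map_mul]
    congr 1
    rw [Equiv.mul_swap_eq_swap_mul]
    rw [show (1 : Fin (n+2)) = (0 : Fin (n+1)).succ from rfl, io_succ, io_zero, io_zero])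
  have hsw : ∀ g : S (n + 2), g.IsSwap → ∃ c : ℂ, ρ g = c • 1 := by
    intro g hg
    obtain ⟨h, rfl⟩ := swap_conj_zero hg
    refine ⟨c, ?_⟩
    rw [map_mul, map_mul, hcs, mul_smul_comm, mul_one, smul_mul_assoc, ← map_mul]
    simp
  have hall : ∀ g : S (n + 2), ∃ c : ℂ, ρ g = c • 1 := by
    intro g
    induction g using Equiv.Perm.swap_induction_on with
    | one => exact ⟨1, by simp⟩
    | swap_mul f x y hxy ih =>
      obtain ⟨c1, h1⟩ := hsw (swap x y) ⟨x, y, hxy, rfl⟩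
      obtain ⟨c2, h2⟩ := ih
      exact ⟨c1 * c2, by rw [map_mul, h1, h2, smul_mul_smul_comm, mul_one]⟩
  have hM : ∀ M : Module.End ℂ V, ∃ c : ℂ, M = c • 1 := by
    intro M
    apply scalar_of_commute ρ
    intro g
    obtain ⟨c, hc⟩ := hall g
    rw [hc]; simp
  have hfr : Module.finrank ℂ (Module.End ℂ V) ≤ 1 :=
    finrank_le_one 1 fun M => by obtain ⟨c, hc⟩ := hM M; exact ⟨c, hc.symm⟩
  rw [Module.finrank_linearMap] at hfr
  have hp := finrank_pos_of_irr ρ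
  have : Module.finrank ℂ V = 1 := by nlinarith
  simp [dg, this]

end loc
end MVC
set_option linter.unusedSectionVars false
namespace MVC
open Representation Equiv

section onedim
variable {G : Type} [Group G] [Fintype G]

lemma isIrr_of_hom (f : G →* ℂ) : IsIrr (f : G → ℂ) := by
  let ρ : Representation ℂ G ℂ :=
    { toFun := fun g => f g • 1
      map_one' := by simp
      map_mul' := fun a b => by rw [map_mul, smul_mul_smul_comm, mul_one] }
  have hρ : ∀ g, ρ g = f g • 1 := fun g => rfl
  obtain ⟨U, _, hU, hirr⟩ := exists_irr_sub ρ ⊤ (fun _ _ _ => Submodule.mem_top) top_ne_bot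
  refine ⟨U, _, _, inferInstance, sub ρ U hU, hirr, ?_⟩
  have h1 : Module.finrank ℂ U = 1 := by
    have h1 := finrank_pos_of_irr (sub ρ U hU)
    have h2 := Submodule.finrank_le U
    rw [Module.finrank_self] at h2
    omega
  ext g
  have : sub ρ U hU g = f g • 1 := by
    ext u
    rfl
  rw [Representation.character, this, map_smul, LinearMap.trace_one, h1]
  simp

lemma hom_of_one {χ : G → ℂ} (h : IsIrr χ) (hd : dg χ = 1) : ∃ f : G →* ℂ, χ = f := by
  have h1 := h.deg_eq
  obtain ⟨V, _, _, _, ρ, hρ, rfl⟩ := h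
  rw [hd, ρ.char_one] at h1
  have hfr : Module.finrank ℂ V = 1 := by exact_mod_cast h1
  have hM : ∀ M : Module.End ℂ V, ∃ c : ℂ, M = c • 1 := by
    intro M
    have h2 : Module.finrank ℂ (Module.End ℂ V) = 1 := by rw [Module.finrank_linearMap, hfr]
    have : Nontrivial V := Module.nontrivial_of_finrank_pos (R := ℂ) (by omega)
    obtain ⟨c, hc⟩ := (finrank_eq_one_iff_of_nonzero' (1 : Module.End ℂ V) one_ne_zero).1 h2 M
    exact ⟨c, hc.symm⟩
  refine ⟨⟨⟨ρ.character, ?_⟩, ?_⟩, rfl⟩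
  · rw [ρ.char_one, hfr]; simp
  · intro a b
    obtain ⟨c, hc⟩ := hM (ρ a)
    obtain ⟨e, he⟩ := hM (ρ b)
    simp [Representation.character, hc, he, hfr, mul_comm]

end onedim

/-- sign character -/
def sgnH (n : ℕ) : S n →* ℂ :=
  ((Int.castRingHom ℂ : ℤ →* ℂ).comp (Units.coeHom ℤ)).comp Equiv.Perm.sign

lemma sgnH_apply (n : ℕ) (g : S n) : sgnH n g = ((Equiv.Perm.sign g : ℤ) : ℂ) := rfl

lemma hom_class {n : ℕ} (f : S n →* ℂ) : f = 1 ∨ f = sgnH n := by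
  have hsq : ∀ x y : Fin n, f (swap x y) = 1 ∨ f (swap x y) = -1 := by
    intro x y
    apply mul_self_eq_one_iff.1
    rw [← map_mul, swap_mul_self, map_one]
  by_cases h : ∀ x y : Fin n, x ≠ y → f (swap x y) = 1
  · left
    ext g
    induction g using Equiv.Perm.swap_induction_on with
    | one => simp
    | swap_mul g x y hxy ih => rw [map_mul, ih, h x y hxy]; simp
  · right
    push Not at h
    obtain ⟨x, y, hxy, hf⟩ := h
    have hf' := (hsq x y).resolve_left hf
    have hall : ∀ z w : Fin n, z ≠ w → f (swap z w) = -1 := by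
      intro z w hzw
      obtain ⟨c, hc⟩ := isConj_iff.1 (Equiv.Perm.isConj_swap hxy hzw)
      rw [← hc, map_mul, map_mul, hf']
      have : f c * f c⁻¹ = 1 := by rw [← map_mul]; simp
      linear_combination -this
    ext g
    induction g using Equiv.Perm.swap_induction_on with
    | one => simp
    | swap_mul g x y hxy ih =>
      rw [map_mul, ih, hall x y hxy, sgnH_apply, sgnH_apply, Equiv.Perm.sign_mul,
        Equiv.Perm.sign_swap hxy]
      simp

lemma sign_io {n : ℕ} (g : S n) : Equiv.Perm.sign (io n g) = Equiv.Perm.sign g := by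
  induction g using Equiv.Perm.swap_induction_on with
  | one => simp
  | swap_mul g x y hxy ih =>
    rw [map_mul, Equiv.Perm.sign_mul, Equiv.Perm.sign_mul, ih, io_swap, Equiv.Perm.sign_swap hxy,
      Equiv.Perm.sign_swap (fun h => hxy (Fin.succ_injective _ h))]

lemma ext_one {n : ℕ} {ψ : S n → ℂ} (h : IsIrr ψ) (hd : dg ψ = 1) :
    ∃ χ : S (n + 1) → ℂ, IsIrr χ ∧ dg χ = 1 ∧ res χ = ψ := by
  obtain ⟨f, rfl⟩ := hom_of_one h hd
  rcases hom_class f with rfl | rfl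
  · exact ⟨_, isIrr_of_hom 1, by simp [dg], by ext g; simp [res]⟩
  · exact ⟨_, isIrr_of_hom (sgnH (n + 1)), by simp [dg],
      by ext g; simp [res, sgnH_apply, sign_io]⟩

section ind
variable {n : ℕ}

/-- extension by zero -/
def exz (ψ : S n → ℂ) (g : S (n + 1)) : ℂ :=
  if (Equiv.Perm.decomposeFin g).1 = 0 then ψ (Equiv.Perm.decomposeFin g).2 else 0

lemma exz_dec (ψ : S n → ℂ) (p : Fin (n + 1)) (e : S n) :
    exz ψ (swap 0 p * io n e) = if p = 0 then ψ e else 0 := by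
  rw [← dec_eq]; simp [exz]

lemma exz_io (ψ : S n → ℂ) (e : S n) : exz ψ (io n e) = ψ e := by
  have := exz_dec ψ 0 e
  rw [show swap (0 : Fin (n+1)) 0 = 1 from swap_self 0, one_mul] at this
  simpa using this

lemma exz_ne (ψ : S n → ℂ) (g : S (n + 1)) (hg : g 0 ≠ 0) : exz ψ g = 0 := by
  obtain ⟨⟨p, e⟩, rfl⟩ := Equiv.Perm.decomposeFin.symm.surjective g
  rw [dec_eq] at *
  rw [exz_dec]
  have : p ≠ 0 := by simpa using hg
  simp [this]

/-- induction -/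
noncomputable def Up (ψ : S n → ℂ) (g : S (n + 1)) : ℂ :=
  (Nat.card (S n) : ℂ)⁻¹ * ∑ x, exz ψ (x * g * x⁻¹)

lemma Up_class (ψ : S n → ℂ) : IsClass (Up ψ) := by
  intro g h
  unfold Up
  congr 1
  apply Fintype.sum_equiv (Equiv.mulRight h)
  intro x
  simp [mul_assoc]

lemma card_S_ne (n : ℕ) : (Nat.card (S n) : ℂ) ≠ 0 := by simp

lemma sum_exz (ψ : S n → ℂ) (F : S (n + 1) → ℂ) :
    ∑ g, exz ψ g * F g = ∑ e, ψ e * F (io n e) := by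
  rw [sum_dec, Fin.sum_univ_succ]
  simp only [exz_dec]
  rw [show swap (0 : Fin (n+1)) 0 = 1 from swap_self 0]
  simp

lemma frob (ψ : S n → ℂ) {χ : S (n + 1) → ℂ} (hχ : IsClass χ) :
    inn (Up ψ) χ = inn ψ (res χ) := by
  unfold inn Up
  have h1 : ∀ x : S (n + 1), ∑ g, exz ψ (x * g * x⁻¹) * χ g⁻¹ = ∑ e, ψ e * χ (io n e)⁻¹ := by
    intro x
    rw [← sum_exz ψ (fun g => χ g⁻¹)]
    apply Fintype.sum_equiv (MulAut.conj x).toEquiv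
    intro g
    simp only [MulEquiv.toEquiv_eq_coe, EquivLike.coe_coe, MulAut.conj_apply]
    congr 1
    rw [show (x * g * x⁻¹)⁻¹ = x * g⁻¹ * x⁻¹ by group, hχ]
  have h2 : ∑ g, ((Nat.card (S n) : ℂ)⁻¹ * ∑ x, exz ψ (x * g * x⁻¹)) * χ g⁻¹ =
      (Nat.card (S n) : ℂ)⁻¹ * ∑ x : S (n + 1), ∑ g, exz ψ (x * g * x⁻¹) * χ g⁻¹ := by
    rw [Finset.sum_comm, Finset.mul_sum]
    refine Finset.sum_congr rfl fun g _ => ?_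
    rw [mul_assoc, Finset.sum_mul]
  rw [h2]
  simp only [h1, Finset.sum_const, Finset.card_univ, nsmul_eq_mul, ← Nat.card_eq_fintype_card]
  have := card_S_ne (n + 1)
  field_simp
  simp [res]

/-- fixed points -/
def fx (g : S n) : ℂ := ∑ i, if g i = i then 1 else 0

lemma res_Up {ψ : S n → ℂ} (hψ : IsClass ψ) (h : S n) : res (Up ψ) h = (1 + fx h) * ψ h := by
  unfold res Up
  rw [sum_dec', Fin.sum_univ_succ]
  have h0 : ∀ e : S n, exz ψ (io n e * swap 0 0 * io n h * (io n e * swap 0 0)⁻¹) = ψ h := by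
    intro e
    rw [show swap (0 : Fin (n+1)) 0 = 1 from swap_self 0, mul_one, ← map_mul, ← map_inv, ← map_mul,
      exz_io, hψ]
  have h1 : ∀ (j : Fin n) (e : S n), exz ψ (io n e * swap 0 j.succ * io n h *
      (io n e * swap 0 j.succ)⁻¹) = (if h j = j then 1 else 0) * ψ h := by
    intro j e
    split_ifs with hj
    · have h2 : io n h * swap 0 j.succ = swap 0 j.succ * io n h := by
        rw [Equiv.mul_swap_eq_swap_mul, io_zero, io_succ, hj]
      have h3 : io n e * swap 0 j.succ * io n h * (io n e * swap 0 j.succ)⁻¹ =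
          io n (e * h * e⁻¹) := by
        rw [mul_assoc (io n e), ← h2]
        simp [mul_assoc]
      rw [h3, exz_io, hψ, one_mul]
    · rw [exz_ne, zero_mul]
      have : (io n e)⁻¹ 0 = 0 := by rw [← map_inv, io_zero]
      simp only [mul_inv_rev, Perm.mul_apply, this, swap_inv, swap_apply_left, io_succ]
      intro h4
      have h5 := (io n e).injective (h4.trans (io_zero e).symm)
      rw [swap_apply_of_ne_of_ne (Fin.succ_ne_zero _)
        (fun h => hj (Fin.succ_injective _ h))] at h5
      exact Fin.succ_ne_zero _ h5
  simp only [h0, h1, Finset.sum_const, Finset.card_univ, nsmul_eq_mul,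
    ← Nat.card_eq_fintype_card, ← Finset.mul_sum, ← Finset.sum_mul]
  have := card_S_ne n
  unfold fx
  field_simp

lemma Up_one (ψ : S n → ℂ) : Up ψ 1 = (n + 1) * ψ 1 := by
  unfold Up
  have : ∀ x : S (n + 1), exz ψ (x * 1 * x⁻¹) = ψ 1 := by
    intro x
    rw [mul_one, mul_inv_cancel, ← map_one (io n), exz_io]
  simp only [this, Finset.sum_const, Finset.card_univ, nsmul_eq_mul, Fintype.card_perm,
    Fintype.card_fin, Nat.card_eq_fintype_card, Nat.factorial_succ]
  have : (n.factorial : ℂ) ≠ 0 := by exact_mod_cast n.factorial_ne_zero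
  push_cast
  field_simp

lemma inn_fx {ψ : S (n + 1) → ℂ} (hψ : IsClass ψ) :
    inn (fun g => fx g * ψ g) ψ = inn (res ψ) (res ψ) := by
  have h1 : ∀ i : Fin (n + 1), ∑ g : S (n + 1), (if g i = i then 1 else 0) * ψ g * ψ g⁻¹ =
      ∑ e, ψ (io n e) * ψ (io n e)⁻¹ := by
    intro i
    have h2 : ∑ g : S (n + 1), (if g i = i then 1 else 0) * ψ g * ψ g⁻¹ =
        ∑ g : S (n + 1), (if g 0 = 0 then 1 else 0) * ψ g * ψ g⁻¹ := by
      apply Fintype.sum_equiv (MulAut.conj (swap 0 i)).toEquiv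
      intro g
      simp only [MulEquiv.toEquiv_eq_coe, EquivLike.coe_coe, MulAut.conj_apply]
      rw [hψ, show (swap 0 i * g * (swap 0 i)⁻¹)⁻¹ = swap 0 i * g⁻¹ * (swap 0 i)⁻¹ by group, hψ]
      congr 3
      simp only [Perm.mul_apply, swap_inv, swap_apply_left, eq_iff_iff]
      rw [Equiv.swap_apply_eq_iff, swap_apply_left]
    rw [h2, sum_dec, Fin.sum_univ_succ]
    have h3 : ∀ (j : Fin n), j.succ ≠ 0 := fun j => Fin.succ_ne_zero j
    rw [show swap (0 : Fin (n+1)) 0 = 1 from swap_self 0]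
    simp
  have h4 : inn (fun g => fx g * ψ g) ψ = (Nat.card (S (n + 1)) : ℂ)⁻¹ *
      ∑ i : Fin (n + 1), ∑ g : S (n + 1), (if g i = i then 1 else 0) * ψ g * ψ g⁻¹ := by
    unfold inn fx
    congr 1
    rw [Finset.sum_comm]
    refine Finset.sum_congr rfl fun g _ => ?_
    simp only [Finset.sum_mul]
  rw [h4]
  simp only [h1, Finset.sum_const, Finset.card_univ, nsmul_eq_mul, Fintype.card_perm,
    Fintype.card_fin, Nat.card_eq_fintype_card, Nat.factorial_succ, inn, res, map_inv]
  have : (n.factorial : ℂ) ≠ 0 := by exact_mod_cast n.factorial_ne_zero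
  have : ((n + 1 : ℕ) : ℂ) ≠ 0 := by exact_mod_cast n.succ_ne_zero
  push_cast at *
  field_simp

open Classical in
/-- parents -/
noncomputable def pa (ψ : S n → ℂ) : Finset (S (n + 1) → ℂ) :=
  (irr (S (n + 1))).filter fun χ => ψ ∈ ch χ

lemma mem_pa {ψ : S n → ℂ} {χ : S (n + 1) → ℂ} : χ ∈ pa ψ ↔ IsIrr χ ∧ ψ ∈ ch χ := by
  simp [pa, mem_irr]

lemma inn_Up {ψ : S n → ℂ} (hψ : IsIrr ψ) {χ : S (n + 1) → ℂ} (hχ : IsIrr χ) [Decidable (ψ ∈ ch χ)] :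
    inn (Up ψ) χ = if ψ ∈ ch χ then 1 else 0 := by
  rw [frob ψ hχ.isClass, inn_comm]
  split_ifs with h
  · exact mult_ch hχ h
  · by_contra h'
    exact h (mem_ch.2 ⟨hψ, h'⟩)

lemma Up_eq {ψ : S n → ℂ} (hψ : IsIrr ψ) (g : S (n + 1)) : Up ψ g = ∑ χ ∈ pa ψ, χ g := by
  classical
  rw [expand (Up_class ψ) g, pa, Finset.sum_filter]
  refine Finset.sum_congr rfl fun χ hχ => ?_
  rw [inn_Up hψ (mem_irr.1 hχ)]
  split_ifs <;> simp

lemma sum_pa {ψ : S n → ℂ} (hψ : IsIrr ψ) : ∑ χ ∈ pa ψ, dg χ = (n + 1) * dg ψ := by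
  have := congrArg Complex.re ((Up_one ψ).symm.trans (Up_eq hψ 1))
  rw [hψ.deg_eq] at this
  rw [Complex.re_sum] at this
  unfold dg at *
  rw [← this]
  norm_cast

lemma card_pa {ψ : S (n + 1) → ℂ} (hψ : IsIrr ψ) : (pa ψ).card = 1 + (ch ψ).card := by
  classical
  have h1 : inn (Up ψ) (Up ψ) = (pa ψ).card := by
    rw [inn_expand (Up_class ψ), Finset.card_eq_sum_ones, Nat.cast_sum, pa, Finset.sum_filter]
    refine Finset.sum_congr rfl fun χ hχ => ?_
    rw [inn_comm χ, inn_Up hψ (mem_irr.1 hχ)]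
    split_ifs <;> simp
  have h2 : inn (Up ψ) (Up ψ) = 1 + (ch ψ).card := by
    rw [frob ψ (Up_class ψ), inn_comm, ← inn_res_self hψ, ← inn_fx hψ.isClass, ← hψ.inn_self]
    have : res (Up ψ) = fun h => (1 + fx h) * ψ h := funext (res_Up hψ.isClass)
    rw [this]
    unfold inn
    rw [← mul_add, ← Finset.sum_add_distrib]
    congr 1
    refine Finset.sum_congr rfl fun g _ => ?_
    ring
  rw [h1] at h2
  exact_mod_cast h2

lemma card_ch_le {χ : S (n + 1) → ℂ} (hχ : IsIrr χ) : ((ch χ).card : ℝ) ≤ dg χ := by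
  rw [dg_eq hχ, Finset.card_eq_sum_ones]
  push_cast
  exact Finset.sum_le_sum fun ψ hψ => (mem_ch.1 hψ).1.one_le_deg

lemma card_ch_pos {χ : S (n + 1) → ℂ} (hχ : IsIrr χ) : 0 < (ch χ).card := by
  rw [Nat.pos_iff_ne_zero]
  intro h
  have h1 := dg_eq hχ
  rw [Finset.card_eq_zero.1 h, Finset.sum_empty] at h1
  have := hχ.one_le_deg
  linarith

/-- parents of a one-dimensional character -/
lemma pa_one {ψ : S (n + 1) → ℂ} (hψ : IsIrr ψ) (hd : dg ψ = 1) {χ : S (n + 2) → ℂ}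
    (hχ : χ ∈ pa ψ) (h1 : 1 < dg χ) : dg χ = n + 1 ∧ ∀ χ' ∈ pa ψ, 1 < dg χ' → χ' = χ := by
  classical
  obtain ⟨θ, hθ, hθd, hθr⟩ := ext_one hψ hd
  have hθp : θ ∈ pa ψ := mem_pa.2 ⟨hθ, mem_ch.2 ⟨hψ, by rw [hθr, hψ.inn_self]; exact one_ne_zero⟩⟩
  have hc : (ch ψ).card = 1 := by
    have h2 := card_ch_le hψ
    rw [hd] at h2
    have h3 := card_ch_pos hψ
    have : (ch ψ).card ≤ 1 := by exact_mod_cast h2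
    omega
  have hcp := card_pa hψ
  rw [hc] at hcp
  have hne : θ ≠ χ := by
    rintro rfl
    linarith
  have hpa : pa ψ = {θ, χ} := by
    symm
    apply Finset.eq_of_subset_of_card_le
    · intro x hx
      simp only [Finset.mem_insert, Finset.mem_singleton] at hx
      rcases hx with rfl | rfl <;> assumption
    · rw [hcp, Finset.card_pair hne]
  constructor
  · have := sum_pa hψ
    rw [hpa, Finset.sum_pair hne, hd, hθd] at this
    push_cast at this
    linarith
  · intro χ' h' h1'
    rw [hpa] at h'
    simp only [Finset.mem_insert, Finset.mem_singleton] at h'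
    rcases h' with rfl | rfl
    · linarith
    · rfl

end ind
end MVC
set_option linter.unusedSectionVars false
namespace MVC
open Representation Equiv

open Classical in
/-- nonlinear irreducible characters -/
noncomputable def nl (n : ℕ) : Finset (S n → ℂ) := (irr (S n)).filter fun χ => 1 < dg χ

lemma mem_nl {n : ℕ} {χ : S n → ℂ} : χ ∈ nl n ↔ IsIrr χ ∧ 1 < dg χ := by simp [nl, mem_irr]

/-- weight -/
noncomputable def wt (r : ℕ) : ℝ := if r ≤ 1 then 0.29 else 1

lemma wt_pos (r : ℕ) : 0 < wt r := by unfold wt; split_ifs <;> norm_num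
lemma wt_le (r : ℕ) : wt r ≤ 1 := by unfold wt; split_ifs <;> norm_num
lemma wt_ge (r : ℕ) : 0.29 ≤ wt r := by unfold wt; split_ifs <;> norm_num

/-- potential -/
noncomputable def Ph (m : ℕ) : ℝ :=
  ∑ χ ∈ nl (m + 1), wt (ch χ).card * (1 / dg χ ^ 2)

lemma tangent {ι : Type*} (s : Finset ι) (hs : s.Nonempty) (x : ι → ℝ) (hx : ∀ i ∈ s, 0 < x i) :
    1 / (∑ i ∈ s, x i) ^ 2 ≤ 1 / (s.card : ℝ) ^ 3 * ∑ i ∈ s, 1 / x i ^ 2 := by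
  have hX : 0 < ∑ i ∈ s, x i := Finset.sum_pos hx hs
  have hr : (0:ℝ) < s.card := by exact_mod_cast hs.card_pos
  set X := ∑ i ∈ s, x i with hXd
  set r : ℝ := (s.card : ℝ)
  set μ := X / r with hμ
  have hμ0 : 0 < μ := by positivity
  have h1 : ∀ i ∈ s, 3 / μ ^ 2 - 2 / μ ^ 3 * x i ≤ 1 / x i ^ 2 := by
    intro i hi
    have hxi := hx i hi
    rw [← sub_nonneg]
    have : 1 / x i ^ 2 - (3 / μ ^ 2 - 2 / μ ^ 3 * x i) =
        (x i - μ) ^ 2 * (2 * x i + μ) / (x i ^ 2 * μ ^ 3) := by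
      field_simp
      ring
    rw [this]
    positivity
  have h2 := Finset.sum_le_sum h1
  rw [Finset.sum_sub_distrib, Finset.sum_const, nsmul_eq_mul, ← Finset.mul_sum, ← hXd] at h2
  have h3 : r * (3 / μ ^ 2) - 2 / μ ^ 3 * X = r ^ 3 / X ^ 2 := by
    rw [hμ]; field_simp; ring
  rw [h3] at h2
  calc 1 / X ^ 2 = 1 / r ^ 3 * (r ^ 3 / X ^ 2) := by field_simp
    _ ≤ _ := by gcongr

lemma wt_bound {r s : ℕ} (hr : 1 ≤ r) (hs : 1 ≤ s) (h : r ≤ s + 1) (h1 : r = 1 → 2 ≤ s) :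
    (1 + r : ℝ) * (wt s * (1 / (s : ℝ) ^ 3)) ≤ 0.9 * wt r := by
  have h8 : 2 ≤ s → wt s * (1 / (s : ℝ) ^ 3) ≤ 1 / 8 := by
    intro h2
    have h2' : (2:ℝ) ≤ s := by exact_mod_cast h2
    have : (8:ℝ) ≤ (s:ℝ) ^ 3 := by
      calc (8:ℝ) = 2 ^ 3 := by norm_num
        _ ≤ _ := by gcongr
    calc wt s * (1 / (s : ℝ) ^ 3) ≤ 1 * (1 / 8) := by
          gcongr
          exact wt_le s
      _ = 1 / 8 := by norm_num
  rcases (by omega : r = 1 ∨ r = 2 ∨ 3 ≤ r) with h0 | h0 | h0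
  · subst h0
    have := h8 (h1 rfl)
    have e : wt 1 = 0.29 := by simp [wt]
    rw [e]
    push_cast
    nlinarith
  · subst h0
    have e : wt 2 = 1 := by simp [wt]
    rw [e]
    rcases (by omega : s = 1 ∨ 2 ≤ s) with h2 | h2
    · subst h2
      have e : wt 1 = 0.29 := by simp [wt]
      rw [e]; norm_num
    · have := h8 h2
      push_cast
      nlinarith
  · have e : wt r = 1 := by simp [wt]; omega
    have e' : wt s = 1 := by simp [wt]; omega
    rw [e, e']
    have h2 : (2:ℝ) ≤ s := by exact_mod_cast (by omega : 2 ≤ s)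
    have h3 : (r:ℝ) ≤ s + 1 := by exact_mod_cast h
    have h4 : (0:ℝ) < (s:ℝ) ^ 3 := by positivity
    rw [one_mul, mul_one_div, div_le_iff₀ h4]
    have : (4:ℝ) * s ≤ (s:ℝ)^3 := by nlinarith [mul_nonneg (sub_nonneg.2 h2) (mul_nonneg (by linarith : (0:ℝ) ≤ s) (by linarith : (0:ℝ) ≤ s + 2))]
    nlinarith

lemma inner_bound {m : ℕ} {ψ : S (m + 1) → ℂ} (hψ : IsIrr ψ) [DecidablePred fun χ : S (m+2) → ℂ => 1 < dg χ] :
    ∑ χ ∈ (pa ψ).filter (fun χ => 1 < dg χ), wt (ch χ).card * (1 / ((ch χ).card : ℝ) ^ 3) ≤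
      0.9 * wt (ch ψ).card := by
  have hp := card_ch_pos hψ
  have h1 : ∀ χ ∈ (pa ψ).filter (fun χ => 1 < dg χ),
      wt (ch χ).card * (1 / ((ch χ).card : ℝ) ^ 3) ≤ 0.9 * wt (ch ψ).card / (1 + (ch ψ).card) := by
    intro χ hχ
    rw [Finset.mem_filter, mem_pa] at hχ
    obtain ⟨⟨hi, hc⟩, hd⟩ := hχ
    rw [le_div_iff₀ (by positivity), mul_comm]
    apply wt_bound hp (card_ch_pos hi) (card_le hi hc)
    intro he
    by_contra hlt
    have := card_ch_pos hi
    have := dg_one_of hi hc (by omega) he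
    linarith
  refine (Finset.sum_le_card_nsmul _ _ _ h1).trans ?_
  rw [nsmul_eq_mul]
  have h2 : ((Finset.filter (fun χ => 1 < dg χ) (pa ψ)).card : ℝ) ≤ 1 + (ch ψ).card := by
    have := Finset.card_filter_le (pa ψ) (fun χ => 1 < dg χ)
    rw [card_pa hψ] at this
    exact_mod_cast this
  have h3 : (0:ℝ) < 1 + (ch ψ).card := by positivity
  have := wt_pos (ch ψ).card
  calc _ ≤ (1 + (ch ψ).card : ℝ) * (0.9 * wt (ch ψ).card / (1 + (ch ψ).card)) := by gcongr
    _ = _ := by field_simp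

lemma lin_card (n : ℕ) [DecidablePred fun χ : S n → ℂ => dg χ = 1] :
    ((irr (S n)).filter fun χ => dg χ = 1).card ≤ 2 := by
  classical
  refine (Finset.card_le_card (t := {((1 : S n →* ℂ) : S n → ℂ), (sgnH n : S n → ℂ)}) ?_).trans
    Finset.card_le_two
  intro χ hχ
  rw [Finset.mem_filter, mem_irr] at hχ
  obtain ⟨f, rfl⟩ := hom_of_one hχ.1 hχ.2
  rcases hom_class f with rfl | rfl <;> simp

lemma Ph_step (m : ℕ) : Ph (m + 1) ≤ 0.9 * Ph m + 2 / ((m : ℝ) + 1) ^ 2 := by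
  classical
  set L := (irr (S (m + 1))).filter fun χ => dg χ = 1 with hL
  have key : ∀ χ ∈ nl (m + 2), wt (ch χ).card * (1 / dg χ ^ 2) ≤
      (∑ ψ ∈ nl (m + 1), if χ ∈ pa ψ then
        wt (ch χ).card * (1 / ((ch χ).card : ℝ) ^ 3) * (1 / dg ψ ^ 2) else 0) +
      ∑ ψ ∈ L, if χ ∈ pa ψ then 1 / dg χ ^ 2 else 0 := by
    intro χ hχ
    rw [mem_nl] at hχ
    obtain ⟨hi, hd⟩ := hχ
    have hnn1 : 0 ≤ (∑ ψ ∈ nl (m + 1), if χ ∈ pa ψ then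
        wt (ch χ).card * (1 / ((ch χ).card : ℝ) ^ 3) * (1 / dg ψ ^ 2) else 0) := by
      apply Finset.sum_nonneg
      intro ψ _
      have := wt_pos (ch χ).card
      split_ifs <;> positivity
    have hnn2 : ∀ ψ ∈ L, (0:ℝ) ≤ if χ ∈ pa ψ then 1 / dg χ ^ 2 else 0 := by
      intro ψ _
      split_ifs <;> positivity
    by_cases h : ∃ ψ ∈ ch χ, dg ψ = 1
    · obtain ⟨ψ, hψ, h1⟩ := h
      have h2 := Finset.single_le_sum hnn2 (a := ψ) (by
        rw [hL, Finset.mem_filter, mem_irr]; exact ⟨(mem_ch.1 hψ).1, h1⟩)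
      rw [if_pos (mem_pa.2 ⟨hi, hψ⟩)] at h2
      have h3 : wt (ch χ).card * (1 / dg χ ^ 2) ≤ 1 / dg χ ^ 2 :=
        mul_le_of_le_one_left (by positivity) (wt_le _)
      linarith
    · push Not at h
      have hch : ch χ = (nl (m + 1)).filter fun ψ => χ ∈ pa ψ := by
        ext ψ
        rw [Finset.mem_filter, mem_nl, mem_pa]
        constructor
        · intro hψ
          have hψi := (mem_ch.1 hψ).1
          exact ⟨⟨hψi, lt_of_le_of_ne hψi.one_le_deg (h ψ hψ).symm⟩, hi, hψ⟩
        · exact fun h => h.2.2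
      have h1 : wt (ch χ).card * (1 / dg χ ^ 2) ≤ (∑ ψ ∈ nl (m + 1), if χ ∈ pa ψ then
        wt (ch χ).card * (1 / ((ch χ).card : ℝ) ^ 3) * (1 / dg ψ ^ 2) else 0) := by
        rw [← Finset.sum_filter, ← hch, ← Finset.mul_sum, mul_assoc]
        apply mul_le_mul_of_nonneg_left _ (wt_pos _).le
        rw [dg_eq hi]
        apply tangent _ (Finset.card_pos.1 (card_ch_pos hi))
        intro ψ hψ
        have := (mem_ch.1 hψ).1.one_le_deg
        linarith
      have := Finset.sum_nonneg hnn2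
      linarith
  refine (Finset.sum_le_sum key).trans ?_
  rw [Finset.sum_add_distrib]
  have hfil : ∀ ψ : S (m + 1) → ℂ, (nl (m + 2)).filter (fun χ => χ ∈ pa ψ) =
      (pa ψ).filter fun χ => 1 < dg χ := by
    intro ψ
    ext χ
    simp only [Finset.mem_filter, mem_nl, mem_pa]
    tauto
  apply add_le_add
  · rw [Finset.sum_comm, Ph, Finset.mul_sum]
    refine Finset.sum_le_sum fun ψ hψ => ?_
    rw [← Finset.sum_filter, hfil, ← Finset.sum_mul, ← mul_assoc]
    exact mul_le_mul_of_nonneg_right (inner_bound (mem_nl.1 hψ).1) (by positivity)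
  · rw [Finset.sum_comm]
    have h1 : ∀ ψ ∈ L, (∑ χ ∈ nl (m + 2), if χ ∈ pa ψ then 1 / dg χ ^ 2 else 0) ≤
        1 / ((m:ℝ) + 1) ^ 2 := by
      intro ψ hψ
      rw [hL, Finset.mem_filter, mem_irr] at hψ
      rw [← Finset.sum_filter, hfil]
      rcases Finset.eq_empty_or_nonempty ((pa ψ).filter fun χ => 1 < dg χ) with h0 | ⟨χ, hχ⟩
      · rw [h0, Finset.sum_empty]; positivity
      · have hχ' := Finset.mem_filter.1 hχ
        obtain ⟨h2, h3⟩ := pa_one hψ.1 hψ.2 hχ'.1 hχ'.2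
        have : (pa ψ).filter (fun χ => 1 < dg χ) = {χ} := by
          rw [Finset.eq_singleton_iff_unique_mem]
          refine ⟨hχ, fun x hx => ?_⟩
          have hx' := Finset.mem_filter.1 hx
          exact h3 x hx'.1 hx'.2
        rw [this, Finset.sum_singleton, h2]
    refine (Finset.sum_le_card_nsmul _ _ _ h1).trans ?_
    rw [nsmul_eq_mul]
    have : (L.card : ℝ) ≤ 2 := by exact_mod_cast lin_card (m + 1)
    calc _ ≤ 2 * (1 / ((m:ℝ) + 1) ^ 2) := by gcongr
      _ = _ := by ring

lemma seq_bound (a : ℕ → ℝ) (h0 : ∀ m, 0 ≤ a m)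
    (h : ∀ m, a (m + 1) ≤ 0.9 * a m + 2 / ((m : ℝ) + 1) ^ 2) :
    ∃ C > (0:ℝ), ∀ m, a m ≤ C / ((m : ℝ) + 1) ^ 2 := by
  set B := ∑ m ∈ Finset.range 61, a m * ((m : ℝ) + 1) ^ 2 with hB
  have hB0 : 0 ≤ B := Finset.sum_nonneg fun m _ => mul_nonneg (h0 m) (by positivity)
  refine ⟨100 + B, by linarith, ?_⟩
  intro m
  induction m with
  | zero =>
    have : a 0 * (((0:ℕ) : ℝ) + 1) ^ 2 ≤ B := Finset.single_le_sum (f := fun m : ℕ => a m * ((m : ℝ) + 1) ^ 2)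
      (fun m _ => mul_nonneg (h0 m) (by positivity)) (by simp)
    rw [le_div_iff₀ (by positivity)]
    linarith
  | succ m ih =>
    by_cases hm : m + 1 < 61
    · have : a (m + 1) * (((m + 1 : ℕ) : ℝ) + 1) ^ 2 ≤ B :=
        Finset.single_le_sum (f := fun m : ℕ => a m * ((m : ℝ) + 1) ^ 2)
        (fun m _ => mul_nonneg (h0 m) (by positivity)) (Finset.mem_range.2 hm)
      rw [le_div_iff₀ (by positivity)]
      linarith
    · have hm' : (60:ℝ) ≤ m := by exact_mod_cast (by omega : 60 ≤ m)
      refine (h m).trans ?_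
      have h1 : 0.9 * a m + 2 / ((m : ℝ) + 1) ^ 2 ≤
          (0.9 * (100 + B) + 2) / ((m : ℝ) + 1) ^ 2 := by
        rw [add_div, mul_div_assoc]
        linarith
      refine h1.trans ?_
      rw [div_le_div_iff₀ (by positivity) (by positivity)]
      push_cast
      have h2 : 0.95 * ((m:ℝ) + 1 + 1) ^ 2 ≤ ((m:ℝ) + 1) ^ 2 := by nlinarith
      have h3 : 0.9 * (100 + B) + 2 ≤ 0.95 * (100 + B) := by linarith
      calc (0.9 * (100 + B) + 2) * ((m:ℝ) + 1 + 1) ^ 2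
          ≤ (0.95 * (100 + B)) * ((m:ℝ) + 1 + 1) ^ 2 := by gcongr
        _ = (100 + B) * (0.95 * ((m:ℝ) + 1 + 1) ^ 2) := by ring
        _ ≤ _ := by gcongr

lemma zeta_bound : ∃ C > (0:ℝ), ∀ n, 1 ≤ n → ∑ χ ∈ nl n, 1 / dg χ ^ 2 ≤ C / (n : ℝ) ^ 2 := by
  obtain ⟨C, hC, h⟩ := seq_bound Ph (fun m => Finset.sum_nonneg fun χ _ =>
    mul_nonneg (wt_pos _).le (by positivity)) Ph_step
  refine ⟨C / 0.29, by positivity, ?_⟩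
  intro n hn
  obtain ⟨m, rfl⟩ : ∃ m, n = m + 1 := ⟨n - 1, by omega⟩
  have h1 : 0.29 * ∑ χ ∈ nl (m + 1), 1 / dg χ ^ 2 ≤ Ph m := by
    rw [Ph, Finset.mul_sum]
    refine Finset.sum_le_sum fun χ _ => ?_
    exact mul_le_mul_of_nonneg_right (wt_ge _) (by positivity)
  have h2 := h m
  push_cast
  rw [div_right_comm, le_div_iff₀ (by norm_num)]
  linarith

end MVC
set_option linter.unusedSectionVars false
namespace MVC
open Representation Equiv

section wcs
variable {n : ℕ}

lemma sum_fin_succ {G M : Type*} [Fintype G] [AddCommMonoid M] {k : ℕ} (F : (Fin (k + 1) → G) → M) :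
    ∑ v, F v = ∑ x, ∑ u : Fin k → G, F (Fin.cons x u) := by
  classical
  rw [← Fintype.sum_prod_type']
  symm
  exact Fintype.sum_equiv (Fin.consEquiv (fun _ => G)) _ _ (fun _ => rfl)

lemma sum_fin_snoc {G M : Type*} [Fintype G] [AddCommMonoid M] {k : ℕ} (F : (Fin (k + 1) → G) → M) :
    ∑ v, F v = ∑ u : Fin k → G, ∑ z, F (Fin.snoc u z) := by
  classical
  rw [Finset.sum_comm, ← Fintype.sum_prod_type']
  symm
  exact Fintype.sum_equiv (Fin.snocEquiv (fun _ => G)) _ _ (fun _ => rfl)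

lemma wc_cons_snoc {k : ℕ} (x z : S n) (u : Fin k → S n) :
    wc (Fin.cons x (Fin.snoc u z) : Fin (k + 2) → S n) =
      x * (List.ofFn u).prod * z * x⁻¹ * (List.ofFn fun i => (u i)⁻¹).prod * z⁻¹ := by
  unfold wc
  have h1 : List.ofFn (Fin.cons x (Fin.snoc u z : Fin (k + 1) → S n) : Fin (k + 2) → S n) =
      x :: (List.ofFn u ++ [z]) := by
    rw [List.ofFn_succ]
    simp only [Fin.cons_zero, Fin.cons_succ]
    rw [List.ofFn_succ']
    simp
  have h2 : List.ofFn (fun i => ((Fin.cons x (Fin.snoc u z : Fin (k + 1) → S n) :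
      Fin (k + 2) → S n) i)⁻¹) = x⁻¹ :: ((List.ofFn fun i => (u i)⁻¹) ++ [z⁻¹]) := by
    rw [List.ofFn_succ]
    simp only [Fin.cons_zero, Fin.cons_succ]
    rw [List.ofFn_succ']
    simp
  rw [h1, h2]
  simp [mul_assoc]

lemma sum_wc_step {χ : S n → ℂ} (h : IsIrr χ) (k : ℕ) :
    ∑ v : Fin (k + 2) → S n, χ (wc v) =
      (Nat.card (S n) : ℂ) ^ 2 / χ 1 ^ 2 * ∑ v : Fin k → S n, χ (wc v) := by
  rw [sum_fin_succ]
  simp only [sum_fin_snoc (G := S n)]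
  rw [Finset.sum_comm, Finset.mul_sum]
  refine Finset.sum_congr rfl fun u _ => ?_
  simp only [wc_cons_snoc]
  set P := (List.ofFn u).prod
  set Q := (List.ofFn fun i => (u i)⁻¹).prod
  have hcl := h.isClass
  have h1 : ∀ x : S n, ∑ z, χ (x * P * z * x⁻¹ * Q * z⁻¹) =
      Nat.card (S n) * χ (x * P) * χ (x⁻¹ * Q) / χ 1 := by
    intro x
    rw [← h.sum_conj]
    refine Finset.sum_congr rfl fun z _ => ?_
    congr 1
  simp only [h1]
  have h2 : ∑ x, χ (x * P) * χ (x⁻¹ * Q) = ∑ y, χ y * χ (y⁻¹ * (Q * P)) := by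
    apply Fintype.sum_equiv (Equiv.mulRight P)
    intro x
    simp only [Equiv.coe_mulRight]
    congr 1
    rw [← mul_assoc, hcl.comm (_ * Q) P]
    congr 1
    group
  have h3 := h.conv (Q * P)
  rw [← h2] at h3
  have h4 : ∑ x, (Nat.card (S n) : ℂ) * χ (x * P) * χ (x⁻¹ * Q) / χ 1 =
      Nat.card (S n) / χ 1 * ∑ x, χ (x * P) * χ (x⁻¹ * Q) := by
    rw [Finset.mul_sum]
    refine Finset.sum_congr rfl fun x _ => by ring
  have h5 : χ (wc u) = χ (Q * P) := hcl.comm P Q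
  rw [h4, h3, h5]
  ring

lemma sum_wc {χ : S n → ℂ} (h : IsIrr χ) (k : ℕ) :
    ∑ v : Fin k → S n, χ (wc v) =
      (Nat.card (S n) : ℂ) ^ k * (χ 1 / χ 1 ^ (2 * (k / 2))) := by
  have h0 := h.ne_zero
  induction k using Nat.strong_induction_on with
  | _ k ih =>
    match k, ih with
    | 0, _ => simp [wc]
    | 1, _ =>
      have : ∀ v : Fin 1 → S n, wc v = 1 := by intro v; simp [wc]
      simp only [this, Finset.sum_const, Finset.card_univ, nsmul_eq_mul, Fintype.card_fun,
        Fintype.card_fin, Nat.card_eq_fintype_card]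
      simp
    | k + 2, ih =>
      rw [sum_wc_step h, ih k (by omega)]
      have : (k + 2) / 2 = k / 2 + 1 := by omega
      rw [this, mul_add, pow_add, pow_add]
      field_simp

lemma sum_class {f : S n → ℂ} (hf : IsClass f) (k : ℕ) :
    (∑ v : Fin k → S n, f (wc v)) / (Nat.card (S n) : ℂ) ^ k =
      ∑ χ ∈ irr (S n), inn f χ * (χ 1 / χ 1 ^ (2 * (k / 2))) := by
  have h1 : ∑ v : Fin k → S n, f (wc v) =
      ∑ χ ∈ irr (S n), inn f χ * ∑ v : Fin k → S n, χ (wc v) := by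
    simp only [Finset.mul_sum]
    rw [Finset.sum_comm]
    exact Finset.sum_congr rfl fun v _ => expand hf _
  rw [h1, Finset.sum_div]
  refine Finset.sum_congr rfl fun χ hχ => ?_
  rw [sum_wc (mem_irr.1 hχ)]
  have := card_S_ne n
  field_simp

lemma lin_eq [DecidableEq (S n → ℂ)] [DecidablePred fun χ : S n → ℂ => 1 < dg χ] :
    (irr (S n)).filter (fun χ => ¬ 1 < dg χ) =
      {((1 : S n →* ℂ) : S n → ℂ), (sgnH n : S n → ℂ)} := by
  ext χ
  rw [Finset.mem_filter, mem_irr]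
  constructor
  · rintro ⟨h1, h2⟩
    obtain ⟨f, rfl⟩ := hom_of_one h1 (le_antisymm (not_lt.1 h2) h1.one_le_deg)
    rcases hom_class f with rfl | rfl <;> simp
  · intro h
    simp only [Finset.mem_insert, Finset.mem_singleton] at h
    rcases h with rfl | rfl
    · exact ⟨isIrr_of_hom _, by simp [dg]⟩
    · exact ⟨isIrr_of_hom _, by simp [dg]⟩

lemma one_ne_sgn (hn : 2 ≤ n) : ((1 : S n →* ℂ) : S n → ℂ) ≠ (sgnH n : S n → ℂ) := by
  intro h
  have := congrFun h (swap ⟨0, by omega⟩ ⟨1, by omega⟩)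
  rw [sgnH_apply, Equiv.Perm.sign_swap (by simp)] at this
  norm_num at this

lemma alt_eq (hn : 2 ≤ n) (f : S n → ℂ) :
    inn f ((1 : S n →* ℂ) : S n → ℂ) + inn f (sgnH n : S n → ℂ) =
      (∑ η : alternatingGroup (Fin n), f η) / (Nat.card (alternatingGroup (Fin n)) : ℂ) := by
  have : Nontrivial (Fin n) := Fin.nontrivial_iff_two_le.2 hn
  have hc := two_mul_card_alternatingGroup (α := Fin n)
  have h1 : (Nat.card (S n) : ℂ) = 2 * (Nat.card (alternatingGroup (Fin n)) : ℂ) := by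
    rw [Nat.card_eq_fintype_card, Nat.card_eq_fintype_card]
    rw [← hc]; push_cast; ring
  have h2 : ∑ η : alternatingGroup (Fin n), f η =
      ∑ g : S n, if Equiv.Perm.sign g = 1 then f g else 0 := by
    rw [← Finset.sum_filter]
    symm
    apply Finset.sum_subtype
    intro x
    simp [Equiv.Perm.mem_alternatingGroup]
  have h3 : (Nat.card (alternatingGroup (Fin n)) : ℂ) ≠ 0 :=
    Nat.cast_ne_zero.2 Nat.card_pos.ne'
  rw [h2]
  unfold inn
  rw [← mul_add, ← Finset.sum_add_distrib, h1]
  have h4 : ∑ g : S n, (f g * ((1 : S n →* ℂ) : S n → ℂ) g⁻¹ + f g * sgnH n g⁻¹) =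
      2 * ∑ g : S n, if Equiv.Perm.sign g = 1 then f g else 0 := by
    rw [Finset.mul_sum]
    refine Finset.sum_congr rfl fun g _ => ?_
    rw [sgnH_apply, Equiv.Perm.sign_inv]
    rcases Int.units_eq_one_or (Equiv.Perm.sign g) with h | h
    · simp [h]; ring
    · simp [h]
  rw [h4]
  field_simp

lemma char_inv {χ : S n → ℂ} (h : IsIrr χ) (g : S n) : χ g⁻¹ = star (χ g) := by
  obtain ⟨V, _, _, _, ρ, hρ, rfl⟩ := h
  exact char_inv_eq_conj ρ g

lemma pars (f : S n → ℝ) (hf : IsClass fun g => (f g : ℂ)) (hi : ∀ g, f g⁻¹ = f g) :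
    ∑ χ ∈ irr (S n), ‖inn (fun g => (f g : ℂ)) χ‖ ^ 2 = (∑ g, f g ^ 2) / (Nat.card (S n) : ℝ) := by
  have h1 := inn_expand (h := fun g => (f g : ℂ)) hf
  have h2 : ∀ χ ∈ irr (S n), inn (fun g => (f g : ℂ)) χ * inn χ (fun g => (f g : ℂ)) =
      ((‖inn (fun g => (f g : ℂ)) χ‖ ^ 2 : ℝ) : ℂ) := by
    intro χ hχ
    have : inn χ (fun g => (f g : ℂ)) = star (inn (fun g => (f g : ℂ)) χ) := by
      unfold inn
      simp only [star_mul', star_sum, star_inv₀, star_natCast, hi, Complex.star_def,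
        Complex.conj_ofReal]
      congr 1
      refine Finset.sum_congr rfl fun g _ => ?_
      rw [char_inv (mem_irr.1 hχ)]
      simp [mul_comm]
    rw [this, Complex.star_def, Complex.mul_conj, Complex.normSq_eq_norm_sq]
  rw [Finset.sum_congr rfl h2] at h1
  have h3 : inn (fun g => (f g : ℂ)) (fun g => (f g : ℂ)) =
      (((∑ g, f g ^ 2) / (Nat.card (S n) : ℝ) : ℝ) : ℂ) := by
    unfold inn
    simp only [hi]
    push_cast
    rw [div_eq_inv_mul]
    congr 1
    refine Finset.sum_congr rfl fun g _ => by ring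
  rw [h3] at h1
  exact_mod_cast h1.symm

lemma sum_pow_le {ι : Type*} (s : Finset ι) (x : ι → ℝ) (hx : ∀ i ∈ s, 0 ≤ x i) (j : ℕ) :
    ∑ i ∈ s, x i ^ (j + 1) ≤ (∑ i ∈ s, x i) ^ (j + 1) := by
  have h0 : 0 ≤ ∑ i ∈ s, x i := Finset.sum_nonneg hx
  calc ∑ i ∈ s, x i ^ (j + 1) ≤ ∑ i ∈ s, (∑ i ∈ s, x i) ^ j * x i := by
        refine Finset.sum_le_sum fun i hi => ?_
        rw [pow_succ]
        apply mul_le_mul_of_nonneg_right _ (hx i hi)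
        exact pow_le_pow_left₀ (hx i hi) (Finset.single_le_sum hx hi) j
    _ = _ := by rw [← Finset.mul_sum, pow_succ]

lemma main_bound (hn : 2 ≤ n) (k : ℕ) (hk : 2 ≤ k) (f : S n → ℝ)
    (hf : IsClass fun g => (f g : ℂ)) (hi : ∀ g, f g⁻¹ = f g) :
    ((∑ v : Fin k → S n, f (wc v)) / (Nat.card (S n) : ℝ) ^ k -
      (∑ η : alternatingGroup (Fin n), f η) / (Nat.card (alternatingGroup (Fin n)) : ℝ)) ^ 2 ≤
      (∑ g, f g ^ 2) / (Nat.card (S n) : ℝ) *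
        (∑ χ ∈ nl n, 1 / dg χ ^ 2) ^ (2 * (k / 2) - 1) := by
  classical
  set F : S n → ℂ := fun g => (f g : ℂ) with hF
  obtain ⟨j, hj⟩ : ∃ j, 2 * (k / 2) = j + 2 := ⟨2 * (k / 2) - 2, by omega⟩
  have h1 : (((∑ v : Fin k → S n, f (wc v)) / (Nat.card (S n) : ℝ) ^ k -
      (∑ η : alternatingGroup (Fin n), f η) / (Nat.card (alternatingGroup (Fin n)) : ℝ) : ℝ) : ℂ)
      = ∑ χ ∈ nl n, inn F χ * ((1 / dg χ ^ (j + 1) : ℝ) : ℂ) := by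
    have h2 := sum_class hf k
    have h3 := alt_eq hn F
    push_cast
    rw [h2, ← h3, ← Finset.sum_filter_add_sum_filter_not (irr (S n)) (fun χ => 1 < dg χ),
      lin_eq, Finset.sum_pair (one_ne_sgn hn)]
    have h4 : ∀ χ ∈ (irr (S n)).filter (fun χ => 1 < dg χ),
        inn F χ * (χ 1 / χ 1 ^ (2 * (k / 2))) = inn F χ * (1 / (dg χ : ℂ) ^ (j + 1)) := by
      intro χ hχ
      have hχi := mem_irr.1 (Finset.mem_filter.1 hχ).1
      have h0 := hχi.ne_zero
      rw [hj, ← hχi.deg_eq]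
      congr 1
      field_simp
      ring
    rw [Finset.sum_congr rfl h4]
    simp [nl, F]
  set D := (∑ v : Fin k → S n, f (wc v)) / (Nat.card (S n) : ℝ) ^ k -
      (∑ η : alternatingGroup (Fin n), f η) / (Nat.card (alternatingGroup (Fin n)) : ℝ)
  have h5 : |D| ≤ ∑ χ ∈ nl n, ‖inn F χ‖ * (1 / dg χ ^ (j + 1)) := by
    have : ‖(D : ℂ)‖ = |D| := by simp
    rw [← this, h1]
    refine (norm_sum_le _ _).trans (Finset.sum_le_sum fun χ hχ => ?_)
    rw [norm_mul]
    apply le_of_eq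
    congr 1
    rw [Complex.norm_real, Real.norm_eq_abs, abs_of_nonneg]
    have := (mem_nl.1 hχ).2
    positivity
  have h6 : D ^ 2 ≤ (∑ χ ∈ nl n, ‖inn F χ‖ * (1 / dg χ ^ (j + 1))) ^ 2 := by
    rw [← sq_abs]
    exact pow_le_pow_left₀ (abs_nonneg _) h5 2
  refine h6.trans ((Finset.sum_mul_sq_le_sq_mul_sq _ _ _).trans ?_)
  apply mul_le_mul
  · rw [← pars f hf hi]
    exact Finset.sum_le_sum_of_subset_of_nonneg (Finset.filter_subset _ _)
      (fun _ _ _ => by positivity)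
  · have h7 : 2 * (k / 2) - 1 = j + 1 := by omega
    rw [h7]
    refine le_trans (le_of_eq ?_) (sum_pow_le _ _ (fun χ _ => by positivity) j)
    refine Finset.sum_congr rfl fun χ _ => ?_
    rw [div_pow, div_pow, one_pow, one_pow, ← pow_mul, ← pow_mul, mul_comm 2]
  · exact Finset.sum_nonneg fun _ _ => by positivity
  · exact div_nonneg (Finset.sum_nonneg fun _ _ => by positivity) (by positivity)

end wcs
end MVC
set_option linter.unusedSectionVars false
namespace MVC
open Equiv

section cyc
variable {n : ℕ}

lemma nc_congr {g h : S n} (e : g.cycleType = h.cycleType) : numCycles g = numCycles h := by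
  have key : ∀ g : S n, (Finset.univ.filter fun i => g i = i).card = n - g.cycleType.sum := by
    intro g
    rw [Equiv.Perm.sum_cycleType]
    have : (Finset.univ.filter fun i => g i = i) = g.supportᶜ := by
      ext i; simp
    rw [this, Finset.card_compl, Fintype.card_fin]
  unfold numCycles
  rw [key, key, e]

lemma nc_inv (g : S n) : numCycles g⁻¹ = numCycles g := nc_congr (Equiv.Perm.cycleType_inv g)

lemma nc_conj (g h : S n) : numCycles (h * g * h⁻¹) = numCycles g :=
  nc_congr Equiv.Perm.cycleType_conj

open Classical in
/-- number of orbits -/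
noncomputable def nQ (g : S n) : ℕ := Fintype.card (Quotient (Equiv.Perm.SameCycle.setoid g))

lemma same_fixed {g : S n} {i j : Fin n} (hi : g i = i) (h : g.SameCycle i j) : i = j := by
  obtain ⟨z, hz⟩ := h
  rw [Equiv.Perm.zpow_apply_eq_self_of_apply_eq_self hi] at hz
  exact hz

lemma nc_le (g : S n) : numCycles g ≤ nQ g := by
  classical
  have h1 : numCycles g = Fintype.card (g.cycleFactorsFinset ⊕ {i : Fin n // g i = i}) := by
    rw [Fintype.card_sum, Fintype.card_coe, Fintype.card_subtype, numCycles,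
      Equiv.Perm.cycleType_def]
    simp
  have hx : ∀ c : g.cycleFactorsFinset, ∃ x, x ∈ c.1.support := by
    intro c
    have := (Equiv.Perm.mem_cycleFactorsFinset_iff.1 c.2).1
    exact Finset.nonempty_iff_ne_empty.2 (by
      intro h
      rw [Equiv.Perm.support_eq_empty_iff] at h
      exact this.ne_one h)
  choose x hx using hx
  have hxs : ∀ c : g.cycleFactorsFinset, g (x c) ≠ x c := by
    intro c
    have := Equiv.Perm.mem_cycleFactorsFinset_support_le c.2 (hx c)
    simpa using this
  rw [h1, nQ]
  apply Fintype.card_le_of_injective (fun s : g.cycleFactorsFinset ⊕ {i : Fin n // g i = i} =>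
    (Quotient.mk (Equiv.Perm.SameCycle.setoid g) (Sum.elim x (fun i => i.1) s)))
  intro s t hst
  have h2 : g.SameCycle (Sum.elim x (fun i => i.1) s) (Sum.elim x (fun i => i.1) t) :=
    Quotient.exact hst
  rcases s with c | i <;> rcases t with c' | j
  · simp only [Sum.elim_inl] at h2
    congr 1
    apply Subtype.ext
    rw [Equiv.Perm.cycle_is_cycleOf (hx c) c.2, Equiv.Perm.cycle_is_cycleOf (hx c') c'.2,
      h2.cycleOf_eq]
  · simp only [Sum.elim_inl, Sum.elim_inr] at h2
    have := same_fixed j.2 h2.symm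
    exact absurd (this ▸ j.2) (hxs c)
  · simp only [Sum.elim_inl, Sum.elim_inr] at h2
    have := same_fixed i.2 h2
    exact absurd (this ▸ i.2) (hxs c')
  · simp only [Sum.elim_inr] at h2
    have := same_fixed i.2 h2
    congr 1
    exact Subtype.ext this

lemma nQ_pos (g : S (n + 1)) : 1 ≤ nQ g := by
  classical
  exact Fintype.card_pos_iff.2 ⟨Quotient.mk _ 0⟩

lemma same_lift (p : Fin (n + 1)) (e : S n) (i : Fin n) :
    (swap 0 p * io n e).SameCycle i.succ (e i).succ := by
  set σ := swap 0 p * io n e with hσ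
  have h1 : σ i.succ = swap 0 p (e i).succ := by simp [hσ]
  by_cases h : (e i).succ = p
  · have h2 : σ i.succ = 0 := by rw [h1, h]; simp
    have h3 : σ 0 = (e i).succ := by rw [hσ, h]; simp
    refine ⟨2, ?_⟩
    rw [show (2:ℤ) = 1 + 1 from rfl, zpow_add, zpow_one, Perm.mul_apply, h2, h3]
  · refine ⟨1, ?_⟩
    rw [zpow_one, h1, swap_apply_of_ne_of_ne (Fin.succ_ne_zero _) h]

lemma same_lift' (p : Fin (n + 1)) (e : S n) {i j : Fin n} (h : e.SameCycle i j) :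
    (swap 0 p * io n e).SameCycle i.succ j.succ := by
  obtain ⟨z, rfl⟩ := h
  induction z using Int.induction_on with
  | zero => simp; exact Equiv.Perm.SameCycle.refl _ _
  | succ k ih =>
    rw [add_comm (k : ℤ) 1, zpow_add, zpow_one, Perm.mul_apply]
    exact ih.trans (same_lift p e _)
  | pred k ih =>
    refine ih.trans ?_
    have := (same_lift p e ((e ^ (-(k:ℤ) - 1)) i)).symm
    rw [← Perm.mul_apply, ← zpow_one_add] at this
    simpa using this

lemma nQ_le (p : Fin (n + 1)) (e : S n) :
    nQ (swap 0 p * io n e) ≤ nQ e + if p = 0 then 1 else 0 := by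
  classical
  set σ := swap 0 p * io n e with hσ
  let F : Quotient (Equiv.Perm.SameCycle.setoid e) → Quotient (Equiv.Perm.SameCycle.setoid σ) :=
    Quotient.map' (fun i => i.succ) (fun i j h => same_lift' p e h)
  have hF : ∀ i : Fin n, F (Quotient.mk _ i) = Quotient.mk _ i.succ := fun i => rfl
  split_ifs with hp
  · unfold nQ
    rw [← Fintype.card_option]
    apply Fintype.card_le_of_surjective (fun o => o.elim (Quotient.mk _ 0) F)
    intro q
    induction q using Quotient.inductionOn with
    | _ i =>
      refine Fin.cases ?_ (fun j => ?_) i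
      · exact ⟨none, rfl⟩
      · exact ⟨some (Quotient.mk _ j), rfl⟩
  · rw [add_zero]
    apply Fintype.card_le_of_surjective F
    intro q
    induction q using Quotient.inductionOn with
    | _ i =>
      refine Fin.cases ?_ (fun j => ?_) i
      · obtain ⟨j, rfl⟩ := Fin.exists_succ_eq.2 hp
        refine ⟨Quotient.mk _ j, ?_⟩
        rw [hF]
        apply Quotient.sound
        refine (show σ.SameCycle 0 j.succ from ⟨1, ?_⟩).symm
        simp [hσ]
      · exact ⟨Quotient.mk _ j, rfl⟩

lemma Z_bound (x : ℝ) (hx : 1 ≤ x) (n : ℕ) :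
    (∑ g : S n, x ^ nQ g) / (n.factorial : ℝ) ≤ Real.exp ((x - 1) * (harmonic n : ℝ)) := by
  induction n with
  | zero =>
    have : ∀ g : S 0, nQ g = 0 := by
      intro g
      classical
      unfold nQ
      rw [Fintype.card_eq_zero_iff]
      exact ⟨fun q => Quotient.inductionOn q fun i => i.elim0⟩
    simp [this]
  | succ n ih =>
    have h1 : ∑ g : S (n + 1), x ^ nQ g ≤ (x + n) * ∑ e : S n, x ^ nQ e := by
      rw [sum_dec]
      calc ∑ p, ∑ e, x ^ nQ (swap 0 p * io n e)
          ≤ ∑ p : Fin (n + 1), ∑ e : S n, x ^ (nQ e + if p = 0 then 1 else 0) := by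
            refine Finset.sum_le_sum fun p _ => Finset.sum_le_sum fun e _ => ?_
            exact pow_le_pow_right₀ hx (nQ_le p e)
        _ = _ := by
            rw [Fin.sum_univ_succ]
            simp [pow_succ, Fin.succ_ne_zero, ← Finset.sum_mul]
            ring
    have h2 : (harmonic (n + 1) : ℝ) = harmonic n + 1 / ((n:ℝ) + 1) := by
      rw [harmonic_succ]; push_cast; ring
    rw [h2, mul_add, Real.exp_add, Nat.factorial_succ]
    have h3 : 1 + (x - 1) * (1 / ((n:ℝ) + 1)) ≤ Real.exp ((x - 1) * (1 / ((n:ℝ) + 1))) := by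
      rw [add_comm]; exact Real.add_one_le_exp _
    have h4 : (0:ℝ) < n.factorial := by exact_mod_cast n.factorial_pos
    have h5 : 1 + (x - 1) * (1 / ((n:ℝ) + 1)) = (x + n) / (n + 1) := by field_simp; ring
    push_cast
    calc (∑ g : S (n + 1), x ^ nQ g) / (((n:ℝ) + 1) * n.factorial)
        ≤ ((x + n) * ∑ e : S n, x ^ nQ e) / (((n:ℝ) + 1) * n.factorial) := by gcongr
      _ = (∑ e : S n, x ^ nQ e) / n.factorial * ((x + n) / (n + 1)) := by field_simp
      _ ≤ _ := by
        rw [← h5]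
        apply mul_le_mul ih h3 _ (Real.exp_nonneg _)
        have : 0 ≤ x - 1 := by linarith
        positivity

lemma mom_bound (j n : ℕ) (hn : 1 ≤ n) :
    (∑ g : S n, (nQ g : ℝ) ^ j) / (n.factorial : ℝ) ≤
      j.factorial * Real.exp 2 * (harmonic n : ℝ) ^ j := by
  set H : ℝ := (harmonic n : ℝ) with hH
  have hH1 : 1 ≤ H := by
    obtain ⟨m, rfl⟩ : ∃ m, n = m + 1 := ⟨n - 1, by omega⟩
    rw [hH]
    clear hH H hn
    induction m with
    | zero => simp [harmonic]
    | succ m ih =>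
      rw [harmonic_succ]
      push_cast at *
      have : (0:ℝ) ≤ ((m:ℝ) + 1 + 1)⁻¹ := by positivity
      linarith
  have hH0 : 0 < H := by linarith
  set t := 1 / H with ht
  have ht0 : 0 ≤ t := by positivity
  have ht1 : t ≤ 1 := by rw [ht, div_le_one hH0]; exact hH1
  have h1 := Z_bound (Real.exp t) (Real.one_le_exp ht0) n
  have h2 : Real.exp ((Real.exp t - 1) * H) ≤ Real.exp 2 := by
    apply Real.exp_le_exp.2
    have h3 := Real.abs_exp_sub_one_sub_id_le (x := t) (by rw [abs_of_nonneg ht0]; exact ht1)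
    have h4 := (abs_le.1 h3).2
    have h5 : Real.exp t - 1 ≤ 2 * t := by nlinarith
    calc (Real.exp t - 1) * H ≤ 2 * t * H := by gcongr
      _ = 2 := by rw [ht]; field_simp
  have h6 : ∀ g : S n, (nQ g : ℝ) ^ j ≤ j.factorial * H ^ j * Real.exp t ^ nQ g := by
    intro g
    have h7 := Real.pow_div_factorial_le_exp (x := t * nQ g) (by positivity) j
    rw [div_le_iff₀ (by exact_mod_cast j.factorial_pos)] at h7
    have h8 : Real.exp (t * nQ g) = Real.exp t ^ nQ g := by rw [mul_comm, Real.exp_nat_mul]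
    rw [h8, ht, mul_pow, div_pow, one_pow] at h7
    calc (nQ g : ℝ) ^ j = H ^ j * (1 / H ^ j * (nQ g : ℝ) ^ j) := by field_simp
      _ ≤ H ^ j * (Real.exp (1 / H) ^ nQ g * j.factorial) := by gcongr
      _ = _ := by rw [ht]; ring
  have h9 := Finset.sum_le_sum fun g (_ : g ∈ (Finset.univ : Finset (S n))) => h6 g
  rw [← Finset.mul_sum] at h9
  have h4 : (0:ℝ) < n.factorial := by exact_mod_cast n.factorial_pos
  calc (∑ g : S n, (nQ g : ℝ) ^ j) / (n.factorial : ℝ)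
      ≤ (j.factorial * H ^ j * ∑ g : S n, Real.exp t ^ nQ g) / (n.factorial : ℝ) := by gcongr
    _ = j.factorial * H ^ j * ((∑ g : S n, Real.exp t ^ nQ g) / (n.factorial : ℝ)) := by ring
    _ ≤ j.factorial * H ^ j * Real.exp 2 := by
      gcongr
      exact h1.trans h2
    _ = _ := by ring

lemma poly_bound (p : Polynomial ℝ) :
    ∃ B > (0:ℝ), ∀ x : ℝ, 1 ≤ x → |p.eval x| ≤ B * x ^ p.natDegree := by
  refine ⟨∑ i ∈ Finset.range (p.natDegree + 1), |p.coeff i| + 1, by positivity, ?_⟩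
  intro x hx
  rw [Polynomial.eval_eq_sum_range]
  refine (Finset.abs_sum_le_sum_abs _ _).trans ?_
  have h1 : ∑ i ∈ Finset.range (p.natDegree + 1), |p.coeff i * x ^ i| ≤
      (∑ i ∈ Finset.range (p.natDegree + 1), |p.coeff i|) * x ^ p.natDegree := by
    rw [Finset.sum_mul]
    refine Finset.sum_le_sum fun i hi => ?_
    rw [abs_mul, abs_of_nonneg (by positivity : 0 ≤ x ^ i)]
    have : i ≤ p.natDegree := by rw [Finset.mem_range] at hi; omega
    gcongr
  have : 0 ≤ x ^ p.natDegree := by positivity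
  linarith

lemma sq_bound (p : Polynomial ℝ) (ℓ : ℕ) (hdeg : p.natDegree = ℓ)
    (hpos : ∀ x : ℝ, 0 ≤ x → 0 ≤ p.eval x)
    (hmono : ∀ x y : ℝ, 0 ≤ x → x ≤ y → p.eval x ≤ p.eval y) :
    ∃ M > (0:ℝ), ∀ n ≥ 2, (∑ g : S n, (p.eval (numCycles g : ℝ)) ^ 2) / (n.factorial : ℝ) ≤
      M * (Real.log n ^ ℓ) ^ 2 := by
  obtain ⟨B, hB, hBp⟩ := poly_bound p
  rw [hdeg] at hBp
  have hl2 : 0 < Real.log 2 := Real.log_pos (by norm_num)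
  set A := 1 + 1 / Real.log 2 with hA
  have hA0 : 0 < A := by positivity
  refine ⟨B ^ 2 * ((2 * ℓ).factorial * Real.exp 2) * A ^ (2 * ℓ), by positivity, ?_⟩
  intro n hn
  have h1 : ∀ g : S n, (p.eval (numCycles g : ℝ)) ^ 2 ≤ B ^ 2 * (nQ g : ℝ) ^ (2 * ℓ) := by
    intro g
    have hq : (1:ℝ) ≤ nQ g := by
      obtain ⟨m, rfl⟩ : ∃ m, n = m + 1 := ⟨n - 1, by omega⟩
      exact_mod_cast nQ_pos g
    have h2 : p.eval (numCycles g : ℝ) ≤ p.eval (nQ g : ℝ) :=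
      hmono _ _ (by positivity) (by exact_mod_cast nc_le g)
    have h3 := hBp _ hq
    have h4 := hpos (numCycles g : ℝ) (by positivity)
    have h5 : p.eval (numCycles g : ℝ) ≤ B * (nQ g : ℝ) ^ ℓ := h2.trans ((le_abs_self _).trans h3)
    calc (p.eval (numCycles g : ℝ)) ^ 2 ≤ (B * (nQ g : ℝ) ^ ℓ) ^ 2 := by gcongr
      _ = _ := by ring
  have h6 := mom_bound (2 * ℓ) n (by omega)
  have hlog : Real.log 2 ≤ Real.log n := Real.log_le_log (by norm_num) (by exact_mod_cast hn)
  have hH : (harmonic n : ℝ) ≤ A * Real.log n := by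
    have := harmonic_le_one_add_log n
    have h7 : 1 ≤ 1 / Real.log 2 * Real.log n := by
      rw [one_div, inv_mul_eq_div, one_le_div hl2]; exact hlog
    rw [hA, add_mul, one_mul]
    linarith
  have hH0 : (0:ℝ) ≤ harmonic n := by
    have : (0:ℚ) ≤ harmonic n := Finset.sum_nonneg fun _ _ => by positivity
    exact_mod_cast this
  have h4 : (0:ℝ) < n.factorial := by exact_mod_cast n.factorial_pos
  calc (∑ g : S n, (p.eval (numCycles g : ℝ)) ^ 2) / (n.factorial : ℝ)
      ≤ (∑ g : S n, B ^ 2 * (nQ g : ℝ) ^ (2 * ℓ)) / (n.factorial : ℝ) := by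
        gcongr with g
        exact h1 g
    _ = B ^ 2 * ((∑ g : S n, (nQ g : ℝ) ^ (2 * ℓ)) / (n.factorial : ℝ)) := by
        rw [← Finset.mul_sum]; ring
    _ ≤ B ^ 2 * ((2 * ℓ).factorial * Real.exp 2 * (A * Real.log n) ^ (2 * ℓ)) := by
        gcongr
        refine h6.trans ?_
        gcongr
    _ = _ := by rw [mul_pow, pow_mul' (Real.log n)]; ring

end cyc

lemma sum_prod_unif {G : Type} [Group G] [Fintype G] (F : G → ℝ) (j : ℕ) :
    ∑ v : Fin (j + 1) → G, F (List.ofFn v).prod = (Fintype.card G : ℝ) ^ j * ∑ g, F g := by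
  classical
  rw [sum_fin_succ, Finset.sum_comm]
  have : ∀ u : Fin j → G, ∑ x, F (List.ofFn (Fin.cons x u : Fin (j + 1) → G)).prod = ∑ g, F g := by
    intro u
    apply Fintype.sum_equiv (Equiv.mulRight (List.ofFn u).prod)
    intro x
    rw [List.ofFn_succ]
    simp
  rw [Finset.sum_congr rfl fun u _ => this u]
  simp

end MVC

theorem moments_of_vertex_count_general (k : ℕ) (hk : 2 ≤ k)
    (p : Polynomial ℝ) (ℓ : ℕ) (hdeg : p.natDegree = ℓ)
    (hpos : ∀ x : ℝ, 0 ≤ x → 0 ≤ p.eval x)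
    (hmono : ∀ x y : ℝ, 0 ≤ x → x ≤ y → p.eval x ≤ p.eval y) :
    (∃ C > (0 : ℝ), ∀ n ≥ 2,
      |(∑ v : Fin k → Equiv.Perm (Fin n), p.eval (numCycles (wc v) : ℝ))
            / (n.factorial : ℝ) ^ k
          - (∑ η : alternatingGroup (Fin n),
              p.eval (numCycles (η : Equiv.Perm (Fin n)) : ℝ))
            / (Nat.card (alternatingGroup (Fin n)) : ℝ)|
        ≤ C * (Real.log n) ^ ℓ / (n : ℝ) ^ (if Even k then k - 1 else k - 2)) ∧
    (∀ n : ℕ,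
      (∑ v : Fin k → Equiv.Perm (Fin n), p.eval (numCycles (List.ofFn v).prod : ℝ))
          / (n.factorial : ℝ) ^ k
        = (∑ π : Equiv.Perm (Fin n), p.eval (numCycles π : ℝ)) / (n.factorial : ℝ) ∧
      (∑ v : Fin k → Equiv.Perm (Fin n),
          p.eval (numCycles (List.ofFn fun i => (v i)⁻¹).prod : ℝ))
          / (n.factorial : ℝ) ^ k
        = (∑ π : Equiv.Perm (Fin n), p.eval (numCycles π : ℝ)) / (n.factorial : ℝ)) := by
  constructor
  · obtain ⟨M, hM, hMb⟩ := MVC.sq_bound p ℓ hdeg hpos hmono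
    obtain ⟨C, hC, hCb⟩ := MVC.zeta_bound
    have he : (if Even k then k - 1 else k - 2) = 2 * (k / 2) - 1 := by
      split_ifs with h
      · rw [Nat.even_iff] at h; omega
      · rw [Nat.even_iff] at h; omega
    rw [he]
    set e := 2 * (k / 2) - 1
    refine ⟨Real.sqrt (M * C ^ e), Real.sqrt_pos.2 (by positivity), ?_⟩
    intro n hn
    have h1 := MVC.main_bound hn k hk (fun g => p.eval (numCycles g : ℝ))
      (by intro g h; simp only [MVC.nc_conj]) (by intro g; simp only [MVC.nc_inv])
    have hcard : (Nat.card (MVC.S n) : ℝ) = n.factorial := by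
      rw [Nat.card_eq_fintype_card, Fintype.card_perm, Fintype.card_fin]
    rw [hcard] at h1
    have hn0 : (0:ℝ) < n := by exact_mod_cast (by omega : 0 < n)
    have hlog : 0 ≤ Real.log n := Real.log_natCast_nonneg n
    refine abs_le_of_sq_le_sq (h1.trans ?_) (by positivity)
    calc _ ≤ M * (Real.log n ^ ℓ) ^ 2 * (C / (n:ℝ) ^ 2) ^ e := by
          apply mul_le_mul (hMb n hn) _ _ (by positivity)
          · apply pow_le_pow_left₀ _ (hCb n (by omega))
            exact Finset.sum_nonneg fun _ _ => by positivity
          · apply pow_nonneg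
            exact Finset.sum_nonneg fun _ _ => by positivity
      _ = _ := by
          rw [div_pow (_ * _), mul_pow, Real.sq_sqrt (by positivity), div_pow, ← pow_mul,
            ← pow_mul, mul_comm 2]
          ring
  · intro n
    obtain ⟨j, rfl⟩ : ∃ j, k = j + 1 := ⟨k - 1, by omega⟩
    have h4 : (n.factorial : ℝ) ≠ 0 := by exact_mod_cast n.factorial_ne_zero
    have h1 := MVC.sum_prod_unif (fun g : Equiv.Perm (Fin n) => p.eval (numCycles g : ℝ)) j
    rw [Fintype.card_perm, Fintype.card_fin] at h1
    have h2 : ∑ v : Fin (j + 1) → Equiv.Perm (Fin n),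
        p.eval (numCycles (List.ofFn fun i => (v i)⁻¹).prod : ℝ) =
        ∑ v : Fin (j + 1) → Equiv.Perm (Fin n), p.eval (numCycles (List.ofFn v).prod : ℝ) := by
      apply Fintype.sum_equiv (Equiv.inv (Fin (j + 1) → Equiv.Perm (Fin n)))
      intro v
      rfl
    rw [h2, h1]
    refine ⟨?_, ?_⟩ <;> · rw [pow_succ]; field_simp
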